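/- arXiv:2208.07072 — 3 statements merged into one kernel-verified Lean document; each statement's English description precedes it below -/
import Mathlib

section
/- Let n ≥ 2, let U ⊆ ℝⁿ be open with B̄(0,R) ⊆ U, and let f ∈ C^∞(U, ℝⁿ) satisfy: J_f(x) ≥ 0 everywhere, the zero set {f = 0} has Lebesgue measure zero, 0 < |f(x)| < 1 off this zero set on B̄(0,R), and ‖cof Df(x)‖ⁿ ≤ K_I · J_f(x)^{n-1} almost everywhere for some constant K_I ≥ 1. Then for almost every t ∈ (0,R): 2(n−1) · ∫_{B(0,t)} J_f / ( |f|ⁿ (log(1/|f|²))ⁿ ) dx ≤ K_I^{1/n} · ω_{n-1}^{1/n} · t^{(n-1)/n} · ( ∫_{∂B(0,t)} J_f / ( |f|ⁿ (log(1/|f|²))ⁿ ) dH^{n-1} )^{(n-1)/n}, where ω_{n-1} = H^{n-1}(S^{n-1}) is the surface measure of the unit sphere. -/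
open MeasureTheory Metric Set
open scoped Topology ENNReal NNReal

/-- The Jacobian matrix of `f` at `x`: the `(i,j)` entry is the partial
derivative `∂ⱼ fᵢ (x)`, so the `i`-th row is the gradient of the `i`-th
component function `fᵢ`. -/
noncomputable def jacobianMatrix {n : ℕ}
    (f : EuclideanSpace ℝ (Fin n) → EuclideanSpace ℝ (Fin n))
    (x : EuclideanSpace ℝ (Fin n)) : Matrix (Fin n) (Fin n) ℝ :=
  Matrix.of fun i j => fderiv ℝ f x (EuclideanSpace.single j (1 : ℝ)) i

/-- The gradient (as a vector of partial derivatives) of a scalar function. -/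
noncomputable def gradVec {n : ℕ}
    (η : EuclideanSpace ℝ (Fin n) → ℝ) (x : EuclideanSpace ℝ (Fin n)) : Fin n → ℝ :=
  fun j => fderiv ℝ η x (EuclideanSpace.single j (1 : ℝ))

/-- The cofactor matrix of a square matrix: the transpose of the adjugate. -/
noncomputable def cofMatrix {n : ℕ} (A : Matrix (Fin n) (Fin n) ℝ) :
    Matrix (Fin n) (Fin n) ℝ := (Matrix.adjugate A).transpose

/-- The operator norm of a matrix, viewed as a linear map between Euclidean spaces. -/
noncomputable def matOpNorm {n : ℕ} (A : Matrix (Fin n) (Fin n) ℝ) : ℝ :=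
  ‖LinearMap.toContinuousLinearMap (Matrix.toEuclideanLin A)‖

/-- The determinant as a continuous multilinear function of the rows. -/
noncomputable def detRowCLM (n : ℕ) :
    ContinuousMultilinearMap ℝ (fun _ : Fin n => Fin n → ℝ) ℝ where
  toMultilinearMap := (Matrix.detRowAlternating (n := Fin n) (R := ℝ)).toMultilinearMap
  cont := Continuous.matrix_det (A := fun M : Fin n → Fin n → ℝ => M) continuous_id

lemma det_updateRow_eq_sum {n : ℕ} (M : Matrix (Fin n) (Fin n) ℝ) (k : Fin n) (w : Fin n → ℝ) :
    (M.updateRow k w).det = ∑ l, w l * (M.updateRow k (Pi.single l 1)).det := by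
  have h := LinearMap.pi_apply_eq_sum_univ
    ((detRowCLM n).toMultilinearMap.toLinearMap M k) w
  have e : ∀ l : Fin n, (fun j => if l = j then (1 : ℝ) else 0) = Pi.single l 1 := by
    intro l; ext j; simp [Pi.single_apply, eq_comm]
  simp only [e, smul_eq_mul] at h
  exact h

lemma det_updateRow_updateRow_swap {n : ℕ} (M : Matrix (Fin n) (Fin n) ℝ) {i k : Fin n}
    (hik : k ≠ i) (u v : Fin n → ℝ) :
    ((M.updateRow i u).updateRow k v).det = -((M.updateRow i v).updateRow k u).det := by
  have h := (Matrix.detRowAlternating (n := Fin n) (R := ℝ)).map_swap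
    ((M.updateRow i v).updateRow k u) hik
  refine Eq.trans ?_ h
  congr 1
  ext a b
  change ((M.updateRow i u).updateRow k v) a b =
    ((M.updateRow i v).updateRow k u) (Equiv.swap k i a) b
  by_cases h1 : a = k
  · subst h1; simp [Matrix.updateRow_apply, hik.symm]
  · by_cases h2 : a = i
    · subst h2; simp [Matrix.updateRow_apply, h1]
    · simp [Matrix.updateRow_apply, h1, h2, Equiv.swap_apply_of_ne_of_ne h1 h2]

lemma sum_det_updateRow_symm_eq_zero {n : ℕ} (M : Matrix (Fin n) (Fin n) ℝ) {i k : Fin n}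
    (hik : k ≠ i) (H : Fin n → Fin n → ℝ) (hH : ∀ j l, H j l = H l j) :
    ∑ j, ((M.updateRow i (Pi.single j 1)).updateRow k (H j)).det = 0 := by
  have h1 : ∑ j, ((M.updateRow i (Pi.single j 1)).updateRow k (H j)).det =
      ∑ j, ∑ l, H j l *
        ((M.updateRow i (Pi.single j 1)).updateRow k (Pi.single l 1)).det :=
    Finset.sum_congr rfl fun j _ => det_updateRow_eq_sum _ _ _
  have h2 : ∑ j, ∑ l, H j l *
        ((M.updateRow i (Pi.single j 1)).updateRow k (Pi.single l 1)).det =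
      -∑ j, ∑ l, H j l *
        ((M.updateRow i (Pi.single j 1)).updateRow k (Pi.single l 1)).det := by
    conv_lhs => rw [Finset.sum_comm]
    rw [← Finset.sum_neg_distrib]
    refine Finset.sum_congr rfl fun j _ => ?_
    rw [← Finset.sum_neg_distrib]
    refine Finset.sum_congr rfl fun l _ => ?_
    rw [hH l j, det_updateRow_updateRow_swap M hik]
    ring
  rw [h1]
  linarith

lemma hasFDerivAt_det_rows {n : ℕ} {E : Type*} [NormedAddCommGroup E] [NormedSpace ℝ E]
    {r : Fin n → E → (Fin n → ℝ)} {r' : Fin n → E →L[ℝ] (Fin n → ℝ)} {x : E}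
    (h : ∀ k, HasFDerivAt (r k) (r' k) x) :
    ∃ L : E →L[ℝ] ℝ, HasFDerivAt (fun y => (Matrix.of fun k => r k y).det) L x ∧
      ∀ v, L v = ∑ k, ((Matrix.of fun k => r k x).updateRow k (r' k v)).det := by
  refine ⟨_, HasFDerivAt.multilinear_comp (detRowCLM n) h, fun v => ?_⟩
  simp only [sum_apply, ContinuousLinearMap.comp_apply]
  rfl

lemma cofMatrix_apply {n : ℕ} (A : Matrix (Fin n) (Fin n) ℝ) (i j : Fin n) :
    cofMatrix A i j = (A.updateRow i (Pi.single j 1)).det := by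
  rw [cofMatrix, Matrix.transpose_apply, Matrix.adjugate_apply]

lemma sum_cofMatrix_mul {n : ℕ} (A : Matrix (Fin n) (Fin n) ℝ) (i k : Fin n) :
    ∑ j, cofMatrix A i j * A k j = if i = k then A.det else 0 := by
  have h := congrFun (congrFun (Matrix.mul_adjugate A) k) i
  rw [Matrix.mul_apply] at h
  simp only [cofMatrix, Matrix.transpose_apply]
  rw [Finset.sum_congr rfl fun j _ => mul_comm _ _, h]
  simp [Matrix.one_apply, eq_comm]

/-- The rows of the Jacobian matrix, and their derivatives. -/
lemma hasFDerivAt_jacobianMatrix_row {n : ℕ}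
    {f : EuclideanSpace ℝ (Fin n) → EuclideanSpace ℝ (Fin n)} {x : EuclideanSpace ℝ (Fin n)}
    (hf : ContDiffAt ℝ 2 f x) (k : Fin n) :
    ∃ L : EuclideanSpace ℝ (Fin n) →L[ℝ] (Fin n → ℝ),
      HasFDerivAt (fun y => jacobianMatrix f y k) L x ∧
      ∀ v l, L v l = fderiv ℝ (fderiv ℝ f) x v (EuclideanSpace.single l (1 : ℝ)) k := by
  have hd : HasFDerivAt (fderiv ℝ f) (fderiv ℝ (fderiv ℝ f) x) x :=
    ((hf.fderiv_right (m := 1) (by norm_num)).differentiableAt (by norm_num)).hasFDerivAt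
  refine ⟨ContinuousLinearMap.pi fun l => (EuclideanSpace.proj k).comp
    ((ContinuousLinearMap.apply ℝ _ (EuclideanSpace.single l (1 : ℝ))).comp
      (fderiv ℝ (fderiv ℝ f) x)), ?_, fun v l => rfl⟩
  rw [hasFDerivAt_pi']
  intro l
  have h1 := ((EuclideanSpace.proj (𝕜 := ℝ) (ι := Fin n) k :
    EuclideanSpace ℝ (Fin n) →L[ℝ] ℝ).hasFDerivAt.comp x
    (((ContinuousLinearMap.apply ℝ (EuclideanSpace ℝ (Fin n))
      (EuclideanSpace.single l (1 : ℝ))).hasFDerivAt).comp x hd))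
  exact h1

/-- The entries of the cofactor matrix of the differential are differentiable, and its rows are
divergence free (the Piola identity). -/
lemma piola_identity {n : ℕ}
    {f : EuclideanSpace ℝ (Fin n) → EuclideanSpace ℝ (Fin n)} {x : EuclideanSpace ℝ (Fin n)}
    (hf : ContDiffAt ℝ 2 f x) (i : Fin n) :
    ∑ j, fderiv ℝ (fun y => cofMatrix (jacobianMatrix f y) i j) x
      (EuclideanSpace.single j (1 : ℝ)) = 0 := by
  choose L hL hL' using fun k => hasFDerivAt_jacobianMatrix_row hf k
  have hsymm : IsSymmSndFDerivAt ℝ f x := hf.isSymmSndFDerivAt (by simp)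
  have key : ∀ j, fderiv ℝ (fun y => cofMatrix (jacobianMatrix f y) i j) x
      (EuclideanSpace.single j (1 : ℝ)) =
      ∑ k, if k = i then 0 else (((jacobianMatrix f x).updateRow i (Pi.single j 1)).updateRow k
        (L k (EuclideanSpace.single j (1 : ℝ)))).det := by
    intro j
    have hrow : ∀ k, HasFDerivAt
        (fun y => ((jacobianMatrix f y).updateRow i (Pi.single j 1)) k)
        (if k = i then 0 else L k) x := by
      intro k
      by_cases hk : k = i
      · subst hk
        simp only [Matrix.updateRow_self, if_true]
        exact hasFDerivAt_const (Pi.single j 1 : Fin n → ℝ) x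
      · simp only [Matrix.updateRow_ne hk, hk, if_false]
        exact hL k
    obtain ⟨M, hM, hM'⟩ := hasFDerivAt_det_rows
      (r := fun k y => ((jacobianMatrix f y).updateRow i (Pi.single j 1)) k) hrow
    have hM2 : HasFDerivAt (fun y => cofMatrix (jacobianMatrix f y) i j) M x := by
      refine hM.congr_of_eventuallyEq (Filter.Eventually.of_forall fun y => ?_)
      exact cofMatrix_apply _ i j
    rw [hM2.fderiv, hM']
    refine Finset.sum_congr rfl fun k _ => ?_
    by_cases hk : k = i
    · simp only [hk, if_true]
      exact Matrix.det_eq_zero_of_row_eq_zero i (fun l => by simp)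
    · simp only [hk, if_false]; rfl
  rw [Finset.sum_congr rfl fun j _ => key j, Finset.sum_comm]
  refine Finset.sum_eq_zero fun k _ => ?_
  by_cases hk : k = i
  · simp [hk]
  · simp only [hk, if_false]
    refine sum_det_updateRow_symm_eq_zero _ hk
      (fun j => L k (EuclideanSpace.single j (1 : ℝ))) fun j l => ?_
    rw [hL', hL', hsymm]

/-- A `C¹` cutoff, equal to `1` on `(-∞, t]` and to `0` on `[r, ∞)`, whose slope is almost the
optimal one. -/
lemma exists_contDiff_cutoff {t r h : ℝ} (hh : 0 < h) (hhr : h < r - t) :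
    ∃ p : ℝ → ℝ, ContDiff ℝ 1 p ∧ (∀ s ≤ t, p s = 1) ∧ (∀ s, r ≤ s → p s = 0) ∧
      (∀ s, 0 ≤ p s) ∧ (∀ s, |deriv p s| ≤ 1 / h) ∧
      (∀ s, s ∉ Icc t r → deriv p s = 0) := by
  let b : ContDiffBump ((t + r) / 2 : ℝ) :=
    { rIn := h / 2, rOut := (r - t) / 2, rIn_pos := by positivity, rIn_lt_rOut := by linarith }
  set ρ : ℝ → ℝ := b.normed volume with hρ
  have hρc : Continuous ρ := b.continuous_normed
  have hsupp : Function.support ρ = Ioo t r := by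
    rw [hρ, b.support_normed_eq, Real.ball_eq_Ioo]
    congr 1 <;> simp only [b] <;> ring
  have hρ0 : ∀ s, s ∉ Ioo t r → ρ s = 0 := by
    intro s hs
    rw [← hsupp] at hs
    simpa using hs
  have hInt : ∫ x, ρ x = 1 := b.integral_normed
  have hρn : ∀ s, 0 ≤ ρ s := fun s => b.nonneg_normed s
  have hρb : ∀ s, ρ s ≤ 1 / h := by
    intro s
    refine (b.normed_le_div_measure_closedBall_rIn volume s).trans_eq ?_
    simp only [b]
    rw [Measure.real, Real.volume_closedBall, ENNReal.toReal_ofReal (by positivity)]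
    congr 1; ring
  have hder : ∀ s, HasDerivAt (fun s => ∫ u in s..r, ρ u) (-ρ s) s := fun s =>
    intervalIntegral.integral_hasDerivAt_left (hρc.intervalIntegrable _ _)
      hρc.stronglyMeasurable.stronglyMeasurableAtFilter hρc.continuousAt
  have hderiv : deriv (fun s => ∫ u in s..r, ρ u) = fun s => -ρ s := funext fun s => (hder s).deriv
  refine ⟨fun s => ∫ u in s..r, ρ u, ?_, ?_, ?_, ?_, ?_, ?_⟩
  · rw [contDiff_one_iff_deriv]
    exact ⟨fun s => (hder s).differentiableAt, by rw [hderiv]; exact hρc.neg⟩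
  · intro s hs
    have hsr : s ≤ r := by linarith
    change ∫ u in s..r, ρ u = 1
    rw [intervalIntegral.integral_of_le hsr, setIntegral_eq_integral_of_forall_compl_eq_zero, hInt]
    intro x hx
    exact hρ0 x fun h' => hx ⟨by linarith [h'.1], h'.2.le⟩
  · intro s hs
    change ∫ u in s..r, ρ u = 0
    rw [intervalIntegral.integral_symm, intervalIntegral.integral_of_le hs,
      setIntegral_eq_zero_of_forall_eq_zero, neg_zero]
    intro x hx
    exact hρ0 x fun h' => by linarith [h'.2, hx.1]
  · intro s
    rcases le_total s r with hs | hs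
    · exact intervalIntegral.integral_nonneg hs fun u _ => hρn u
    · change 0 ≤ ∫ u in s..r, ρ u
      rw [intervalIntegral.integral_symm, intervalIntegral.integral_of_le hs,
        setIntegral_eq_zero_of_forall_eq_zero, neg_zero]
      intro x hx
      exact hρ0 x fun h' => by linarith [h'.2, hx.1]
  · intro s
    rw [hderiv, abs_neg, abs_of_nonneg (hρn s)]
    exact hρb s
  · intro s hs
    rw [hderiv]
    simp only [neg_eq_zero]
    exact hρ0 s fun h' => hs ⟨h'.1.le, h'.2.le⟩

lemma contDiff_comp_norm {E : Type*} [NormedAddCommGroup E] [InnerProductSpace ℝ E]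
    {p : ℝ → ℝ} (hp : ContDiff ℝ 1 p) {t c : ℝ} (ht : 0 < t) (hpt : ∀ s ≤ t, p s = c) :
    ContDiff ℝ 1 (fun x : E => p ‖x‖) := by
  rw [contDiff_iff_contDiffAt]
  intro x
  by_cases hx : x = 0
  · subst hx
    refine (contDiffAt_const (c := c)).congr_of_eventuallyEq ?_
    filter_upwards [ball_mem_nhds (0 : E) ht] with y hy
    exact hpt _ (by simpa using (mem_ball_zero_iff.1 hy).le)
  · exact hp.contDiffAt.comp x (contDiffAt_norm ℝ hx)

lemma norm_fderiv_comp_norm_le {E : Type*} [NormedAddCommGroup E] [InnerProductSpace ℝ E]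
    {p : ℝ → ℝ} (hp : ContDiff ℝ 1 p) {x : E} (hx : x ≠ 0) :
    ‖fderiv ℝ (fun x : E => p ‖x‖) x‖ ≤ |deriv p ‖x‖| := by
  have h1 : HasFDerivAt (fun x : E => ‖x‖) (fderiv ℝ (fun x : E => ‖x‖) x) x :=
    ((contDiffAt_norm ℝ hx (n := 1)).differentiableAt (by norm_num)).hasFDerivAt
  have h2 : HasDerivAt p (deriv p ‖x‖) ‖x‖ :=
    (hp.differentiable (by norm_num)).differentiableAt.hasDerivAt
  have h3 := (h2.comp_hasFDerivAt x h1).fderiv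
  have h4 : ‖fderiv ℝ (fun x : E => ‖x‖) x‖ ≤ 1 := by
    simpa using norm_fderiv_le_of_lipschitz ℝ (lipschitzWith_one_norm (E := E)) (x₀ := x)
  change ‖fderiv ℝ (p ∘ fun x : E => ‖x‖) x‖ ≤ _
  rw [h3, norm_smul, Real.norm_eq_abs]
  exact mul_le_of_le_one_right (abs_nonneg _) h4

/-- The integral of a directional derivative of a compactly supported `C¹` function vanishes. -/
lemma integral_fderiv_eq_zero_of_hasCompactSupport {n : ℕ} {g : EuclideanSpace ℝ (Fin n) → ℝ}
    (hg : ContDiff ℝ 1 g) (hc : HasCompactSupport g) (v : EuclideanSpace ℝ (Fin n)) :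
    Integrable (fun x => fderiv ℝ g x v) ∧ ∫ x, fderiv ℝ g x v = 0 := by
  have hi : Integrable (fun x => fderiv ℝ g x v) :=
    ((hg.continuous_fderiv (by norm_num)).clm_apply continuous_const).integrable_of_hasCompactSupport
      (hc.fderiv_apply (𝕜 := ℝ) v)
  refine ⟨hi, ?_⟩
  have := integral_mul_fderiv_eq_neg_fderiv_mul_of_integrable (μ := volume)
    (f := fun _ : EuclideanSpace ℝ (Fin n) => (1 : ℝ)) (g := g) (v := v)
    (by simp) (by simpa using hi) (by simpa using hg.continuous.integrable_of_hasCompactSupport hc)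
    (fun x _ => differentiableAt_const _) (fun x _ => hg.differentiable (by norm_num) x)
  simpa using this

lemma contDiffAt_cofMatrix_jacobianMatrix {n : ℕ}
    {f : EuclideanSpace ℝ (Fin n) → EuclideanSpace ℝ (Fin n)} {x : EuclideanSpace ℝ (Fin n)}
    (hf : ContDiffAt ℝ 2 f x) (i j : Fin n) :
    ContDiffAt ℝ 1 (fun y => cofMatrix (jacobianMatrix f y) i j) x := by
  have hent : ∀ k l, ContDiffAt ℝ 1 (fun y => jacobianMatrix f y k l) x := by
    intro k l
    have h1 : ContDiffAt ℝ 1 (fun y => fderiv ℝ f y (EuclideanSpace.single l (1 : ℝ))) x :=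
      (hf.fderiv_right (m := 1) (by norm_num)).clm_apply contDiffAt_const
    exact (EuclideanSpace.proj (𝕜 := ℝ) (ι := Fin n) k :
      EuclideanSpace ℝ (Fin n) →L[ℝ] ℝ).contDiff.contDiffAt.comp x h1
  have h2 : ContDiffAt ℝ 1 (fun y => fun k l =>
      (jacobianMatrix f y).updateRow i (Pi.single j 1) k l) x := by
    rw [contDiffAt_pi]
    intro k
    rw [contDiffAt_pi]
    intro l
    by_cases hk : k = i
    · simp only [Matrix.updateRow_apply, hk, if_true]
      exact contDiffAt_const
    · simp only [Matrix.updateRow_apply, hk, if_false]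
      exact hent k l
  have h3 := ((detRowCLM n).contDiff (n := 1)).contDiffAt.comp x h2
  refine h3.congr_of_eventuallyEq (Filter.Eventually.of_forall fun y => ?_)
  exact cofMatrix_apply _ i j

lemma continuousAt_det_jacobianMatrix {n : ℕ}
    {f : EuclideanSpace ℝ (Fin n) → EuclideanSpace ℝ (Fin n)} {x : EuclideanSpace ℝ (Fin n)}
    (hf : ContDiffAt ℝ 2 f x) :
    ContinuousAt (fun y => (jacobianMatrix f y).det) x := by
  have hent : ContinuousAt (fun y => fun k l => jacobianMatrix f y k l) x := by
    refine continuousAt_pi.2 fun k => continuousAt_pi.2 fun l => ?_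
    have h1 : ContinuousAt (fun y => fderiv ℝ f y (EuclideanSpace.single l (1 : ℝ))) x :=
      ((hf.fderiv_right (m := 1) (by norm_num)).clm_apply contDiffAt_const).continuousAt
    exact (EuclideanSpace.proj (𝕜 := ℝ) (ι := Fin n) k :
      EuclideanSpace ℝ (Fin n) →L[ℝ] ℝ).continuous.continuousAt.comp h1
  exact ((detRowCLM n).cont.continuousAt).comp hent

/-- The vector field `cof(Df)ᵀ (V ∘ f)` for the radial field `V y = a (‖y‖²) y`. -/
noncomputable def pulledField {n : ℕ} (f : EuclideanSpace ℝ (Fin n) → EuclideanSpace ℝ (Fin n))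
    (a : ℝ → ℝ) (j : Fin n) (y : EuclideanSpace ℝ (Fin n)) : ℝ :=
  ∑ i, cofMatrix (jacobianMatrix f y) i j * (a (‖f y‖ ^ 2) * f y i)

lemma contDiffAt_pulledField {n : ℕ}
    {f : EuclideanSpace ℝ (Fin n) → EuclideanSpace ℝ (Fin n)} {x : EuclideanSpace ℝ (Fin n)}
    (hf : ContDiffAt ℝ 2 f x) {a : ℝ → ℝ} (ha : ContDiffAt ℝ 1 a (‖f x‖ ^ 2)) (j : Fin n) :
    ContDiffAt ℝ 1 (pulledField f a j) x := by
  have hf1 : ContDiffAt ℝ 1 f x := hf.of_le (by norm_num)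
  refine ContDiffAt.sum fun i _ => (contDiffAt_cofMatrix_jacobianMatrix hf i j).mul
    (ContDiffAt.mul ?_ ?_)
  · exact ha.comp x (hf1.norm_sq ℝ)
  · exact (EuclideanSpace.proj (𝕜 := ℝ) (ι := Fin n) i :
      EuclideanSpace ℝ (Fin n) →L[ℝ] ℝ).contDiff.contDiffAt.comp x hf1

/-- The divergence of the pulled back radial field. -/
lemma divergence_pulledField {n : ℕ}
    {f : EuclideanSpace ℝ (Fin n) → EuclideanSpace ℝ (Fin n)} {x : EuclideanSpace ℝ (Fin n)}
    (hf : ContDiffAt ℝ 2 f x) {a : ℝ → ℝ} (ha : DifferentiableAt ℝ a (‖f x‖ ^ 2)) :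
    ∑ j, fderiv ℝ (pulledField f a j) x (EuclideanSpace.single j (1 : ℝ)) =
      (n * a (‖f x‖ ^ 2) + 2 * ‖f x‖ ^ 2 * deriv a (‖f x‖ ^ 2)) * (jacobianMatrix f x).det := by
  have hfd : HasFDerivAt f (fderiv ℝ f x) x := (hf.differentiableAt (by norm_num)).hasFDerivAt
  set s := ‖f x‖ ^ 2 with hs
  set A := jacobianMatrix f x with hA
  let e : Fin n → EuclideanSpace ℝ (Fin n) := fun j => EuclideanSpace.single j (1 : ℝ)
  have hproj : ∀ i, HasFDerivAt (fun y => f y i)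
      ((EuclideanSpace.proj (𝕜 := ℝ) (ι := Fin n) i :
        EuclideanSpace ℝ (Fin n) →L[ℝ] ℝ).comp (fderiv ℝ f x)) x := fun i =>
    (EuclideanSpace.proj (𝕜 := ℝ) (ι := Fin n) i :
        EuclideanSpace ℝ (Fin n) →L[ℝ] ℝ).hasFDerivAt.comp x hfd
  have hproj' : ∀ i j, ((EuclideanSpace.proj (𝕜 := ℝ) (ι := Fin n) i :
        EuclideanSpace ℝ (Fin n) →L[ℝ] ℝ).comp (fderiv ℝ f x)) (e j) = A i j := fun i j => rfl
  have hsq : HasFDerivAt (fun y => ‖f y‖ ^ 2) (2 • (innerSL ℝ (f x)).comp (fderiv ℝ f x)) x :=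
    hfd.norm_sq
  have hsq' : ∀ j, (2 • (innerSL ℝ (f x)).comp (fderiv ℝ f x)) (e j) =
      2 * ∑ k, f x k * A k j := by
    intro j
    simp only [_root_.smul_apply, ContinuousLinearMap.comp_apply, innerSL_apply_apply,
      PiLp.inner_apply, nsmul_eq_mul, Nat.cast_ofNat]
    congr 1
    refine Finset.sum_congr rfl fun k _ => ?_
    exact mul_comm _ _
  have hac := ha.hasDerivAt.comp_hasFDerivAt x hsq
  have hcof : ∀ i j, HasFDerivAt (fun y => cofMatrix (jacobianMatrix f y) i j)
      (fderiv ℝ (fun y => cofMatrix (jacobianMatrix f y) i j) x) x := fun i j =>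
    ((contDiffAt_cofMatrix_jacobianMatrix hf i j).differentiableAt (by norm_num)).hasFDerivAt
  have hW : ∀ j, fderiv ℝ (pulledField f a j) x (e j) =
      ∑ i, (cofMatrix A i j * (a s * A i j + f x i * (deriv a s * (2 * ∑ k, f x k * A k j))) +
        (a s * f x i) * fderiv ℝ (fun y => cofMatrix (jacobianMatrix f y) i j) x (e j)) := by
    intro j
    have h1 := HasFDerivAt.fun_sum (u := Finset.univ) fun i _ => (hcof i j).mul (hac.mul (hproj i))
    have h2 : fderiv ℝ (pulledField f a j) x = _ := h1.fderiv
    rw [h2, sum_apply]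
    refine Finset.sum_congr rfl fun i _ => ?_
    simp only [_root_.add_apply, _root_.smul_apply, hproj', hsq', smul_eq_mul]
    rfl
  calc ∑ j, fderiv ℝ (pulledField f a j) x (e j)
      = ∑ i, (a s * ∑ j, cofMatrix A i j * A i j) +
        ∑ i, f x i * deriv a s * 2 * ∑ k, f x k * ∑ j, cofMatrix A i j * A k j +
        ∑ i, (a s * f x i) *
          ∑ j, fderiv ℝ (fun y => cofMatrix (jacobianMatrix f y) i j) x (e j) := by
        rw [Finset.sum_congr rfl fun j _ => hW j, Finset.sum_comm, ← Finset.sum_add_distrib,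
          ← Finset.sum_add_distrib]
        refine Finset.sum_congr rfl fun i _ => ?_
        simp only [Finset.mul_sum, mul_add, Finset.sum_add_distrib]
        congr 2
        · exact Finset.sum_congr rfl fun j _ => by ring
        · rw [Finset.sum_comm]
          exact Finset.sum_congr rfl fun j _ => Finset.sum_congr rfl fun k _ => by ring
    _ = _ := by
        simp only [e, piola_identity hf, sum_cofMatrix_mul, mul_zero, Finset.sum_const_zero,
          add_zero, if_true, Finset.sum_const, Finset.card_univ, Fintype.card_fin, mul_ite,
          Finset.sum_ite_eq, Finset.mem_univ, nsmul_eq_mul]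
        have hs2 : s = ∑ i, f x i * f x i := by
          rw [hs, EuclideanSpace.norm_sq_eq]
          exact Finset.sum_congr rfl fun i _ => by rw [Real.norm_eq_abs, sq_abs, sq]
        have : ∑ i, f x i * deriv a s * 2 * (f x i * A.det) = 2 * s * deriv a s * A.det := by
          nth_rw 2 [hs2]
          rw [Finset.mul_sum, Finset.sum_mul, Finset.sum_mul]
          exact Finset.sum_congr rfl fun i _ => by ring
        rw [this]; ring

lemma abs_sum_cofMatrix_le {n : ℕ} (A : Matrix (Fin n) (Fin n) ℝ)
    (L : EuclideanSpace ℝ (Fin n) →L[ℝ] ℝ) (v : EuclideanSpace ℝ (Fin n)) :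
    |∑ j, L (EuclideanSpace.single j (1 : ℝ)) * ∑ i, A i j * v i| ≤
      ‖L‖ * (matOpNorm A * ‖v‖) := by
  let w : EuclideanSpace ℝ (Fin n) := WithLp.toLp 2 fun j => L (EuclideanSpace.single j (1 : ℝ))
  have hL : ∀ y : EuclideanSpace ℝ (Fin n), L y = inner ℝ w y := by
    intro y
    have : y = ∑ j, y j • EuclideanSpace.single j (1 : ℝ) := by
      ext k; simp [Finset.sum_apply, Pi.single_apply]
    conv_lhs => rw [this]
    rw [map_sum, PiLp.inner_apply]
    refine Finset.sum_congr rfl fun j _ => ?_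
    rw [map_smul, smul_eq_mul]
    rfl
  have hw : ‖w‖ ≤ ‖L‖ := by
    have h1 : ‖w‖ * ‖w‖ ≤ ‖L‖ * ‖w‖ := by
      rw [← real_inner_self_eq_norm_mul_norm, ← hL]
      exact (le_abs_self _).trans (L.le_opNorm w)
    rcases (norm_nonneg w).eq_or_lt with h0 | h0
    · rw [← h0]; exact norm_nonneg _
    · exact le_of_mul_le_mul_right h1 h0
  have hsum : ∑ j, L (EuclideanSpace.single j (1 : ℝ)) * ∑ i, A i j * v i =
      inner ℝ v (LinearMap.toContinuousLinearMap (Matrix.toEuclideanLin A) w) := by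
    rw [PiLp.inner_apply]
    have : ∀ i, (LinearMap.toContinuousLinearMap (Matrix.toEuclideanLin A) w) i =
        ∑ j, A i j * L (EuclideanSpace.single j (1 : ℝ)) := fun i => rfl
    simp only [RCLike.inner_apply, conj_trivial, this, Finset.mul_sum, Finset.sum_mul]
    rw [Finset.sum_comm]
    exact Finset.sum_congr rfl fun i _ => Finset.sum_congr rfl fun j _ => by ring
  rw [hsum]
  calc _ ≤ ‖v‖ * ‖LinearMap.toContinuousLinearMap (Matrix.toEuclideanLin A) w‖ :=
        abs_real_inner_le_norm _ _
    _ ≤ ‖v‖ * (matOpNorm A * ‖w‖) := by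
        gcongr
        exact ContinuousLinearMap.le_opNorm _ _
    _ ≤ ‖v‖ * (matOpNorm A * ‖L‖) := by
        gcongr
        exact norm_nonneg _
    _ = _ := by ring

lemma continuousOn_matOpNorm_cofMatrix {n : ℕ}
    {f : EuclideanSpace ℝ (Fin n) → EuclideanSpace ℝ (Fin n)} {S : Set (EuclideanSpace ℝ (Fin n))}
    (hf : ∀ x ∈ S, ContDiffAt ℝ 2 f x) :
    ContinuousOn (fun x => matOpNorm (cofMatrix (jacobianMatrix f x))) S := by
  intro x hx
  refine ContinuousAt.continuousWithinAt ?_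
  let T : (Fin n → Fin n → ℝ) →ₗ[ℝ] (EuclideanSpace ℝ (Fin n) →L[ℝ] EuclideanSpace ℝ (Fin n)) :=
    { toFun := fun M => LinearMap.toContinuousLinearMap (Matrix.toEuclideanLin (Matrix.of M))
      map_add' := fun M N => by
        rw [← map_add, ← map_add]; rfl
      map_smul' := fun c M => by
        rw [RingHom.id_apply, ← map_smul, ← map_smul]; rfl }
  have hT : Continuous T := T.continuous_of_finiteDimensional
  have hc : ContinuousAt (fun y => fun i j => cofMatrix (jacobianMatrix f y) i j) x :=
    continuousAt_pi.2 fun i => continuousAt_pi.2 fun j =>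
      (contDiffAt_cofMatrix_jacobianMatrix (hf x hx) i j).continuousAt
  exact (hT.continuousAt.comp hc).norm

/-- The integral of the divergence of a pulled back radial field over a ball is controlled by
its mean flux through a spherical shell. -/
lemma integral_divergence_le_shell {n : ℕ}
    {f : EuclideanSpace ℝ (Fin n) → EuclideanSpace ℝ (Fin n)} {t r R h : ℝ}
    (ht : 0 < t) (hrR : r < R) (hh : 0 < h) (hhr : h < r - t)
    (hf : ∀ x ∈ ball (0 : EuclideanSpace ℝ (Fin n)) R, ContDiffAt ℝ 2 f x)
    (hf1 : ∀ x ∈ ball (0 : EuclideanSpace ℝ (Fin n)) R, ‖f x‖ ^ 2 < 1)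
    (hJ : ∀ x ∈ ball (0 : EuclideanSpace ℝ (Fin n)) R, 0 ≤ (jacobianMatrix f x).det)
    {a : ℝ → ℝ} (ha : ∀ s, s < 1 → ContDiffAt ℝ 1 a s)
    (hpos : ∀ s, 0 ≤ s → s < 1 → 0 ≤ n * a s + 2 * s * deriv a s) :
    IntegrableOn (fun x => (n * a (‖f x‖ ^ 2) + 2 * ‖f x‖ ^ 2 * deriv a (‖f x‖ ^ 2)) *
      (jacobianMatrix f x).det) (ball (0 : EuclideanSpace ℝ (Fin n)) t) ∧
    IntegrableOn (fun x => matOpNorm (cofMatrix (jacobianMatrix f x)) *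
      (|a (‖f x‖ ^ 2)| * ‖f x‖)) (closedBall (0 : EuclideanSpace ℝ (Fin n)) r \ ball 0 t) ∧
    ∫ x in ball (0 : EuclideanSpace ℝ (Fin n)) t,
      (n * a (‖f x‖ ^ 2) + 2 * ‖f x‖ ^ 2 * deriv a (‖f x‖ ^ 2)) * (jacobianMatrix f x).det ≤
    1 / h * ∫ x in closedBall (0 : EuclideanSpace ℝ (Fin n)) r \ ball 0 t,
      matOpNorm (cofMatrix (jacobianMatrix f x)) * (|a (‖f x‖ ^ 2)| * ‖f x‖) := by
  obtain ⟨p, hp, hp1, hp0, hpn, hpd, -⟩ := exists_contDiff_cutoff (t := t) (r := r) hh hhr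
  have htr : t < r := by linarith
  let ψ : EuclideanSpace ℝ (Fin n) → ℝ := fun x => p ‖x‖
  have hψ : ContDiff ℝ 1 ψ := contDiff_comp_norm hp ht hp1
  let dv : EuclideanSpace ℝ (Fin n) → ℝ := fun x =>
    (n * a (‖f x‖ ^ 2) + 2 * ‖f x‖ ^ 2 * deriv a (‖f x‖ ^ 2)) * (jacobianMatrix f x).det
  let N : EuclideanSpace ℝ (Fin n) → ℝ := fun x =>
    matOpNorm (cofMatrix (jacobianMatrix f x)) * (|a (‖f x‖ ^ 2)| * ‖f x‖)
  have hsub : closedBall (0 : EuclideanSpace ℝ (Fin n)) r ⊆ ball 0 R := closedBall_subset_ball hrR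
  have hfc : ∀ x ∈ ball (0 : EuclideanSpace ℝ (Fin n)) R, ContinuousAt f x :=
    fun x hx => (hf x hx).continuousAt
  have hac : ∀ x ∈ ball (0 : EuclideanSpace ℝ (Fin n)) R,
      ContinuousAt (fun x => a (‖f x‖ ^ 2)) x := fun x hx =>
    ContinuousAt.comp (g := a) (f := fun x => ‖f x‖ ^ 2) (ha _ (hf1 x hx)).continuousAt
      ((hfc x hx).norm.pow 2)
  have hdac : ∀ x ∈ ball (0 : EuclideanSpace ℝ (Fin n)) R,
      ContinuousAt (fun x => deriv a (‖f x‖ ^ 2)) x := fun x hx =>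
    ContinuousAt.comp (g := deriv a) (f := fun x => ‖f x‖ ^ 2)
      (((ha _ (hf1 x hx)).fderiv_right (m := 0) (by norm_num)).continuousAt.clm_apply
        continuousAt_const) ((hfc x hx).norm.pow 2)
  have hdvc : ContinuousOn dv (ball 0 R) := fun x hx => ContinuousAt.continuousWithinAt <|
    ((continuousAt_const.mul (hac x hx)).add
      ((continuousAt_const.mul ((hfc x hx).norm.pow 2)).mul (hdac x hx))).mul
      (continuousAt_det_jacobianMatrix (hf x hx))
  have hNc : ContinuousOn N (ball 0 R) :=
    (continuousOn_matOpNorm_cofMatrix hf).mul fun x hx => ContinuousAt.continuousWithinAt <|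
      (hac x hx).abs.mul (hfc x hx).norm
  have hψc : Continuous ψ := hψ.continuous
  have hcomp : IsCompact (closedBall (0 : EuclideanSpace ℝ (Fin n)) r) := isCompact_closedBall _ _
  have hdvi : IntegrableOn dv (closedBall 0 r) := (hdvc.mono hsub).integrableOn_compact hcomp
  have hψdvi : IntegrableOn (fun x => ψ x * dv x) (closedBall 0 r) :=
    (hψc.continuousOn.mul (hdvc.mono hsub)).integrableOn_compact hcomp
  have hNi : IntegrableOn N (closedBall 0 r) := (hNc.mono hsub).integrableOn_compact hcomp
  have hNi' : IntegrableOn N (closedBall 0 r \ ball 0 t) := hNi.mono_set sdiff_subset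
  have htsub : ball (0 : EuclideanSpace ℝ (Fin n)) t ⊆ closedBall 0 r :=
    ball_subset_closedBall.trans (closedBall_subset_closedBall htr.le)
  have hdvi' : IntegrableOn dv (ball 0 t) := hdvi.mono_set htsub
  refine ⟨hdvi', hNi', ?_⟩
  let g : Fin n → EuclideanSpace ℝ (Fin n) → ℝ := fun j x => ψ x * pulledField f a j x
  have hgz : ∀ j, ∀ x, r ≤ ‖x‖ → g j x = 0 := fun j x hx => by
    simp only [g, ψ, hp0 _ hx, zero_mul]
  have hgc : ∀ j, ContDiff ℝ 1 (g j) := by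
    intro j
    rw [contDiff_iff_contDiffAt]
    intro x
    by_cases hx : x ∈ ball (0 : EuclideanSpace ℝ (Fin n)) R
    · exact hψ.contDiffAt.mul (contDiffAt_pulledField (hf x hx) (ha _ (hf1 x hx)) j)
    · refine (contDiffAt_const (c := (0 : ℝ))).congr_of_eventuallyEq ?_
      have hx' : r < ‖x‖ := by
        rw [mem_ball_zero_iff, not_lt] at hx; linarith
      filter_upwards [(isOpen_lt continuous_const continuous_norm).mem_nhds hx'] with y hy
      exact hgz j y (le_of_lt hy)
  have hgs : ∀ j, HasCompactSupport (g j) := fun j =>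
    HasCompactSupport.intro hcomp fun x hx => hgz j x (by
      rw [mem_closedBall_zero_iff, not_le] at hx; exact hx.le)
  have hInt := fun j => integral_fderiv_eq_zero_of_hasCompactSupport (hgc j) (hgs j)
    (EuclideanSpace.single j (1 : ℝ))
  let D : EuclideanSpace ℝ (Fin n) → ℝ := fun x =>
    ∑ j, fderiv ℝ (g j) x (EuclideanSpace.single j (1 : ℝ))
  have hDi : Integrable D := integrable_finsetSum _ fun j _ => (hInt j).1
  have hD0 : ∫ x in closedBall 0 r, D x = 0 := by
    rw [setIntegral_eq_integral_of_forall_compl_eq_zero]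
    · simp only [D]
      rw [integral_finsetSum _ fun j _ => (hInt j).1]
      exact Finset.sum_eq_zero fun j _ => (hInt j).2
    · intro x hx
      rw [mem_closedBall_zero_iff, not_le] at hx
      refine Finset.sum_eq_zero fun j _ => ?_
      have : g j =ᶠ[𝓝 x] fun _ => 0 := by
        filter_upwards [(isOpen_lt continuous_const continuous_norm).mem_nhds hx] with y hy
        exact hgz j y (le_of_lt hy)
      rw [this.fderiv_eq]; simp
  let fl : EuclideanSpace ℝ (Fin n) → ℝ := fun x =>
    ∑ j, fderiv ℝ ψ x (EuclideanSpace.single j (1 : ℝ)) * pulledField f a j x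
  have hDeq : ∀ x ∈ ball (0 : EuclideanSpace ℝ (Fin n)) R, D x = fl x + ψ x * dv x := by
    intro x hx
    have h1 : ∀ j, fderiv ℝ (g j) x (EuclideanSpace.single j (1 : ℝ)) =
        fderiv ℝ ψ x (EuclideanSpace.single j (1 : ℝ)) * pulledField f a j x +
        ψ x * fderiv ℝ (pulledField f a j) x (EuclideanSpace.single j (1 : ℝ)) := by
      intro j
      have h2 := fderiv_fun_mul (hψ.differentiable (by norm_num) x)
        ((contDiffAt_pulledField (hf x hx) (ha _ (hf1 x hx)) j).differentiableAt (by norm_num))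
      simp only [g]
      rw [h2]
      simp only [_root_.add_apply, _root_.smul_apply, smul_eq_mul]
      ring
    simp only [D, fl, dv]
    rw [Finset.sum_congr rfl fun j _ => h1 j, Finset.sum_add_distrib, ← Finset.mul_sum,
      divergence_pulledField (hf x hx) ((ha _ (hf1 x hx)).differentiableAt (by norm_num))]
  have hflb : ∀ x ∈ closedBall (0 : EuclideanSpace ℝ (Fin n)) r,
      ψ x * dv x - D x ≤ (closedBall 0 r \ ball 0 t).indicator (fun x => 1 / h * N x) x := by
    intro x hx
    have h1 : ψ x * dv x - D x = - fl x := by rw [hDeq x (hsub hx)]; ring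
    rw [h1]
    by_cases hxt : x ∈ ball (0 : EuclideanSpace ℝ (Fin n)) t
    · rw [indicator_of_notMem (fun h' => h'.2 hxt)]
      have : ψ =ᶠ[𝓝 x] fun _ => 1 := by
        filter_upwards [isOpen_ball.mem_nhds hxt] with y hy
        exact hp1 _ (mem_ball_zero_iff.1 hy).le
      have h0 : fderiv ℝ ψ x = 0 := by rw [this.fderiv_eq]; simp
      simp [fl, h0]
    · rw [indicator_of_mem (show x ∈ closedBall 0 r \ ball 0 t from ⟨hx, hxt⟩)]
      have hx0 : x ≠ 0 := by
        rintro rfl; exact hxt (mem_ball_self ht)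
      have h2 := abs_sum_cofMatrix_le (cofMatrix (jacobianMatrix f x)) (fderiv ℝ ψ x)
        (a (‖f x‖ ^ 2) • f x)
      have h3 : fl x = ∑ j, fderiv ℝ ψ x (EuclideanSpace.single j (1 : ℝ)) *
          ∑ i, cofMatrix (jacobianMatrix f x) i j * (a (‖f x‖ ^ 2) • f x) i := rfl
      rw [← h3, norm_smul, Real.norm_eq_abs] at h2
      refine (neg_le_abs _).trans (h2.trans ?_)
      have h4 : ‖fderiv ℝ ψ x‖ ≤ 1 / h := (norm_fderiv_comp_norm_le hp hx0).trans (hpd _)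
      exact mul_le_mul_of_nonneg_right h4
        (mul_nonneg (norm_nonneg _) (mul_nonneg (abs_nonneg _) (norm_nonneg _)))
  have hshell : MeasurableSet (closedBall (0 : EuclideanSpace ℝ (Fin n)) r \ ball 0 t) :=
    measurableSet_closedBall.diff measurableSet_ball
  have hdvn : ∀ x ∈ ball (0 : EuclideanSpace ℝ (Fin n)) R, 0 ≤ dv x := fun x hx =>
    mul_nonneg (hpos _ (by positivity) (hf1 x hx)) (hJ x hx)
  calc ∫ x in ball 0 t, dv x = ∫ x in ball 0 t, ψ x * dv x := by
        refine setIntegral_congr_fun measurableSet_ball fun x hx => ?_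
        have : ψ x = 1 := hp1 _ (mem_ball_zero_iff.1 hx).le
        simp [this]
    _ ≤ ∫ x in closedBall 0 r, ψ x * dv x := by
        refine setIntegral_mono_set hψdvi ?_ htsub.eventuallyLE
        refine (ae_restrict_iff' measurableSet_closedBall).2 (Filter.Eventually.of_forall ?_)
        intro x hx
        exact mul_nonneg (hpn _) (hdvn x (hsub hx))
    _ = ∫ x in closedBall 0 r, (ψ x * dv x - D x) := by
        rw [integral_sub hψdvi hDi.integrableOn, hD0, sub_zero]
    _ ≤ ∫ x in closedBall 0 r, (closedBall 0 r \ ball 0 t).indicator (fun x => 1 / h * N x) x := by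
        refine setIntegral_mono_on (hψdvi.sub hDi.integrableOn) ?_ measurableSet_closedBall hflb
        exact (hNi.const_mul _).indicator hshell
    _ = 1 / h * ∫ x in closedBall 0 r \ ball 0 t, N x := by
        rw [setIntegral_indicator hshell, inter_eq_self_of_subset_right sdiff_subset,
          integral_const_mul]

/-- The profile `s ↦ s^{-n/2} log^{-(n-1)}(1/s)`, cut off near `s = 0`. -/
noncomputable def logProfile (n : ℕ) (δ s : ℝ) : ℝ :=
  Real.smoothTransition (s / δ - 1) * (((-Real.log s) ^ (n - 1))⁻¹ * s ^ (-(n : ℝ) / 2))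

lemma logProfile_eq_zero (n : ℕ) {δ s : ℝ} (hδ : 0 < δ) (hs : s ≤ δ) : logProfile n δ s = 0 := by
  rw [logProfile, Real.smoothTransition.zero_of_nonpos, zero_mul]
  rw [sub_nonpos, div_le_one hδ]
  exact hs

lemma contDiffAt_logProfile (n : ℕ) {δ s : ℝ} (hδ : 0 < δ) (hs : s < 1) :
    ContDiffAt ℝ 1 (logProfile n δ) s := by
  rcases lt_or_ge s δ with h | h
  · refine (contDiffAt_const (c := (0 : ℝ))).congr_of_eventuallyEq ?_
    filter_upwards [Iio_mem_nhds h] with y hy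
    exact logProfile_eq_zero n hδ (le_of_lt hy)
  · have hs0 : 0 < s := hδ.trans_le h
    refine ContDiffAt.mul ?_ (ContDiffAt.mul ?_ ?_)
    · exact (Real.smoothTransition.contDiff (n := 1)).contDiffAt.comp s
        ((contDiffAt_id.div_const δ).sub contDiffAt_const)
    · refine ((Real.contDiffAt_log.2 hs0.ne').neg.pow (n - 1)).inv ?_
      exact pow_ne_zero _ (neg_ne_zero.2 (Real.log_neg hs0 hs).ne)
    · exact Real.contDiffAt_rpow_const_of_ne hs0.ne'

lemma logProfile_nonneg (n : ℕ) {δ s : ℝ} (hs0 : 0 ≤ s) (hs : s < 1) : 0 ≤ logProfile n δ s := by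
  have h1 : Real.log s ≤ 0 := Real.log_nonpos hs0 hs.le
  refine mul_nonneg (Real.smoothTransition.nonneg _) (mul_nonneg (inv_nonneg.2 ?_) ?_)
  · exact pow_nonneg (by linarith) _
  · exact Real.rpow_nonneg hs0 _

lemma logProfile_le (n : ℕ) {δ s : ℝ} (hs0 : 0 ≤ s) (hs : s < 1) :
    logProfile n δ s ≤ ((-Real.log s) ^ (n - 1))⁻¹ * s ^ (-(n : ℝ) / 2) := by
  have h1 : Real.log s ≤ 0 := Real.log_nonpos hs0 hs.le
  refine mul_le_of_le_one_left (mul_nonneg (inv_nonneg.2 ?_) ?_) (Real.smoothTransition.le_one _)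
  · exact pow_nonneg (by linarith) _
  · exact Real.rpow_nonneg hs0 _

lemma le_divergence_logProfile {n : ℕ} (hn : 2 ≤ n) {δ s : ℝ} (hδ : 0 < δ) (hs0 : 0 < s)
    (hs : s < 1) :
    Real.smoothTransition (s / δ - 1) *
      (2 * ((n : ℝ) - 1) * (((-Real.log s) ^ n)⁻¹ * s ^ (-(n : ℝ) / 2))) ≤
    n * logProfile n δ s + 2 * s * deriv (logProfile n δ) s := by
  obtain ⟨m, rfl⟩ : ∃ m, n = m + 2 := ⟨n - 2, by omega⟩
  have hL : 0 < -Real.log s := by linarith [Real.log_neg hs0 hs]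
  set q := s ^ (-((m + 2 : ℕ) : ℝ) / 2) with hq
  have hq0 : 0 < q := Real.rpow_pos_of_pos hs0 _
  have hθd : HasDerivAt (fun s => Real.smoothTransition (s / δ - 1))
      (deriv Real.smoothTransition (s / δ - 1) * (1 / δ)) s := by
    have h1 : HasDerivAt Real.smoothTransition (deriv Real.smoothTransition (s / δ - 1))
        (s / δ - 1) :=
      ((Real.smoothTransition.contDiff (n := 1)).differentiable (by norm_num) _).hasDerivAt
    exact h1.comp s (((hasDerivAt_id s).div_const δ).sub_const 1)
  have hθ' : 0 ≤ deriv Real.smoothTransition (s / δ - 1) :=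
    Real.smoothTransition.monotone.deriv_nonneg
  have hΛ : HasDerivAt (fun s => ((-Real.log s) ^ (m + 1))⁻¹)
      ((m + 1 : ℝ) / (s * (-Real.log s) ^ (m + 2))) s := by
    have h1 := ((((Real.hasDerivAt_log hs0.ne').neg).pow (m + 1)).inv
      (pow_ne_zero _ hL.ne'))
    refine h1.congr_deriv ?_
    simp only [Nat.add_sub_cancel, Nat.cast_add, Nat.cast_one, Pi.neg_apply, Pi.pow_apply]
    field_simp
    ring
  have hr : HasDerivAt (fun s : ℝ => s ^ (-((m + 2 : ℕ) : ℝ) / 2))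
      ((-((m + 2 : ℕ) : ℝ) / 2) * (q / s)) s := by
    have h1 := Real.hasDerivAt_rpow_const (x := s) (p := -((m + 2 : ℕ) : ℝ) / 2) (Or.inl hs0.ne')
    rw [Real.rpow_sub_one hs0.ne'] at h1
    exact h1
  have hd : deriv (logProfile (m + 2) δ) s = _ := (hθd.mul (hΛ.mul hr)).deriv
  rw [hd]
  simp only [logProfile, show m + 2 - 1 = m + 1 from rfl, ← hq, Pi.mul_apply]
  set θ := Real.smoothTransition (s / δ - 1)
  set θ' := deriv Real.smoothTransition (s / δ - 1)
  set L := -Real.log s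
  have hnn : 0 ≤ 2 * s * (θ' * (1 / δ) * ((L ^ (m + 1))⁻¹ * q)) := by positivity
  have key : 2 * s * ((m + 1 : ℝ) / (s * L ^ (m + 2)) * q) =
      2 * (((m + 2 : ℕ) : ℝ) - 1) * ((L ^ (m + 2))⁻¹ * q) := by
    push_cast
    field_simp
    ring
  have key2 : 2 * s * ((-((m + 2 : ℕ) : ℝ) / 2) * (q / s)) = -((m + 2 : ℕ) : ℝ) * q := by
    field_simp
  rw [← key]
  have e : 2 * s * (θ' * (1 / δ) * ((L ^ (m + 1))⁻¹ * q) +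
      θ * ((m + 1 : ℝ) / (s * L ^ (m + 2)) * q +
        (L ^ (m + 1))⁻¹ * ((-((m + 2 : ℕ) : ℝ) / 2) * (q / s)))) =
      2 * s * (θ' * (1 / δ) * ((L ^ (m + 1))⁻¹ * q)) +
      θ * (2 * s * ((m + 1 : ℝ) / (s * L ^ (m + 2)) * q)) +
      θ * (L ^ (m + 1))⁻¹ * (2 * s * ((-((m + 2 : ℕ) : ℝ) / 2) * (q / s))) := by ring
  rw [e, key2]
  linarith [show ((m + 2 : ℕ) : ℝ) * (θ * ((L ^ (m + 1))⁻¹ * q)) +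
    θ * (L ^ (m + 1))⁻¹ * (-((m + 2 : ℕ) : ℝ) * q) = 0 by ring]

/-- The integrand `J_f / (|f|ⁿ logⁿ (1 / |f|²))`. -/
noncomputable def logDensity {n : ℕ} (f : EuclideanSpace ℝ (Fin n) → EuclideanSpace ℝ (Fin n))
    (x : EuclideanSpace ℝ (Fin n)) : ℝ :=
  (jacobianMatrix f x).det / (‖f x‖ ^ n * Real.log (1 / ‖f x‖ ^ 2) ^ n)

lemma logDensity_nonneg {n : ℕ} {f : EuclideanSpace ℝ (Fin n) → EuclideanSpace ℝ (Fin n)}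
    {x : EuclideanSpace ℝ (Fin n)} (hf1 : ‖f x‖ ^ 2 < 1) (hJ : 0 ≤ (jacobianMatrix f x).det) :
    0 ≤ logDensity f x := by
  refine div_nonneg hJ (mul_nonneg (by positivity) (pow_nonneg ?_ _))
  rw [one_div, Real.log_inv]
  linarith [Real.log_nonpos (by positivity) hf1.le]

lemma sq_rpow_neg_half {n : ℕ} {w : ℝ} (hw : 0 ≤ w) :
    (w ^ 2) ^ (-(n : ℝ) / 2) = (w ^ n)⁻¹ := by
  rw [← Real.rpow_natCast w 2, ← Real.rpow_mul hw, ← Real.rpow_natCast w n, ← Real.rpow_neg hw]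
  congr 1
  push_cast
  ring

lemma mul_logProfile_le {n : ℕ} (hn : 2 ≤ n) {δ w M J K : ℝ} (hw : 0 ≤ w)
    (hw1 : w ^ 2 < 1) (hM : 0 ≤ M) (hJ : 0 ≤ J) (hK : 0 ≤ K) (h : M ^ n ≤ K * J ^ (n - 1)) :
    M * (|logProfile n δ (w ^ 2)| * w) ≤
      K ^ ((1 : ℝ) / n) * (J / (w ^ n * Real.log (1 / w ^ 2) ^ n)) ^ (((n : ℝ) - 1) / n) := by
  have hn0 : n ≠ 0 := by omega
  rw [abs_of_nonneg (logProfile_nonneg n (sq_nonneg w) hw1)]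
  have hlog : 0 ≤ Real.log (1 / w ^ 2) := by
    rw [one_div, Real.log_inv]
    linarith [Real.log_nonpos (by positivity) hw1.le]
  have hR0 : 0 ≤ K ^ ((1 : ℝ) / n) *
      (J / (w ^ n * Real.log (1 / w ^ 2) ^ n)) ^ (((n : ℝ) - 1) / n) := by positivity
  rcases hw.eq_or_lt with rfl | hw0
  · simpa using hR0
  have hL : 0 < Real.log (1 / w ^ 2) := by
    rw [one_div, Real.log_inv]
    linarith [Real.log_neg (by positivity) hw1]
  set L := Real.log (1 / w ^ 2) with hLd
  have hLn : -Real.log (w ^ 2) = L := by rw [hLd, one_div, Real.log_inv]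
  refine le_of_pow_le_pow_left₀ hn0 hR0 ?_
  have h1 : M * (logProfile n δ (w ^ 2) * w) ≤ M / (w * L) ^ (n - 1) := by
    rw [div_eq_mul_inv]
    refine mul_le_mul_of_nonneg_left ?_ hM
    refine (mul_le_mul_of_nonneg_right (logProfile_le n (sq_nonneg w) hw1) hw).trans (le_of_eq ?_)
    rw [sq_rpow_neg_half hw, hLn]
    obtain ⟨m, rfl⟩ : ∃ m, n = m + 1 := ⟨n - 1, by omega⟩
    simp only [Nat.add_sub_cancel]
    field_simp
    ring
  have h0 : 0 ≤ M * (logProfile n δ (w ^ 2) * w) :=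
    mul_nonneg hM (mul_nonneg (logProfile_nonneg n (sq_nonneg w) hw1) hw)
  refine (pow_le_pow_left₀ h0 h1 n).trans ?_
  have e1 : (K ^ ((1 : ℝ) / n)) ^ n = K := by
    rw [one_div, Real.rpow_inv_natCast_pow hK hn0]
  have e2 : ((J / (w ^ n * L ^ n)) ^ (((n : ℝ) - 1) / n)) ^ n = (J / (w ^ n * L ^ n)) ^ (n - 1) := by
    rw [← Real.rpow_natCast _ n, ← Real.rpow_mul (by positivity), ← Real.rpow_natCast _ (n - 1),
      div_mul_cancel₀ _ (by positivity), Nat.cast_sub (by omega), Nat.cast_one]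
  rw [mul_pow (K ^ _), e1, e2, div_pow, div_pow, ← mul_pow w L n, ← pow_mul, ← pow_mul, mul_comm n,
    ← mul_div_assoc]
  exact div_le_div_of_nonneg_right h (by positivity)

lemma smoothTransition_mul_le {n : ℕ} (hn : 2 ≤ n) {δ w J : ℝ} (hδ : 0 < δ) (hw : 0 ≤ w)
    (hw1 : w ^ 2 < 1) (hJ : 0 ≤ J) :
    Real.smoothTransition (w ^ 2 / δ - 1) *
      (2 * ((n : ℝ) - 1) * (J / (w ^ n * Real.log (1 / w ^ 2) ^ n))) ≤
    (n * logProfile n δ (w ^ 2) + 2 * w ^ 2 * deriv (logProfile n δ) (w ^ 2)) * J := by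
  rcases hw.eq_or_lt with rfl | hw0
  · simp [Real.smoothTransition.zero_of_nonpos (x := -1) (by norm_num),
      logProfile_eq_zero n hδ hδ.le]
  · refine le_trans (le_of_eq ?_)
      (mul_le_mul_of_nonneg_right (le_divergence_logProfile hn hδ (pow_pos hw0 2) hw1) hJ)
    rw [sq_rpow_neg_half hw, one_div, Real.log_inv, div_eq_mul_inv J, mul_inv]
    ring

lemma divergence_logProfile_nonneg {n : ℕ} (hn : 2 ≤ n) {δ s : ℝ} (hδ : 0 < δ) (hs0 : 0 ≤ s)
    (hs : s < 1) : 0 ≤ n * logProfile n δ s + 2 * s * deriv (logProfile n δ) s := by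
  rcases hs0.eq_or_lt with rfl | hs0
  · simp [logProfile_eq_zero n hδ hδ.le]
  · refine le_trans ?_ (le_divergence_logProfile hn hδ hs0 hs)
    have h1 : (0 : ℝ) ≤ (n : ℝ) - 1 := by
      have : (2 : ℝ) ≤ n := by exact_mod_cast hn
      linarith
    have h2 : 0 ≤ -Real.log s := by linarith [Real.log_nonpos hs0.le hs.le]
    have := Real.smoothTransition.nonneg (s / δ - 1)
    positivity

lemma logDensity_eq_zero {n : ℕ} (hn : n ≠ 0)
    {f : EuclideanSpace ℝ (Fin n) → EuclideanSpace ℝ (Fin n)}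
    {x : EuclideanSpace ℝ (Fin n)} (hx : f x = 0) : logDensity f x = 0 := by
  simp [logDensity, hx, hn]

/-- The shell form of the isoperimetric inequality, before applying Hölder's inequality. -/
lemma integral_logDensity_le_shell {n : ℕ} (hn : 2 ≤ n)
    {f : EuclideanSpace ℝ (Fin n) → EuclideanSpace ℝ (Fin n)} {t r R K : ℝ}
    (ht : 0 < t) (htr : t < r) (hrR : r < R) (hK : 0 ≤ K)
    (hf : ∀ x ∈ ball (0 : EuclideanSpace ℝ (Fin n)) R, ContDiffAt ℝ 2 f x)
    (hf1 : ∀ x ∈ ball (0 : EuclideanSpace ℝ (Fin n)) R, ‖f x‖ ^ 2 < 1)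
    (hJ : ∀ x ∈ ball (0 : EuclideanSpace ℝ (Fin n)) R, 0 ≤ (jacobianMatrix f x).det)
    (hcof : ∀ᵐ x ∂(volume.restrict (ball (0 : EuclideanSpace ℝ (Fin n)) R)),
      matOpNorm (cofMatrix (jacobianMatrix f x)) ^ n ≤ K * (jacobianMatrix f x).det ^ (n - 1))
    (hg : IntegrableOn (logDensity f) (closedBall 0 r)) :
    2 * ((n : ℝ) - 1) * ∫ x in ball (0 : EuclideanSpace ℝ (Fin n)) t, logDensity f x ≤
      1 / (r - t) * ∫ x in closedBall (0 : EuclideanSpace ℝ (Fin n)) r \ ball 0 t,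
        K ^ ((1 : ℝ) / n) * logDensity f x ^ (((n : ℝ) - 1) / n) := by
  have hn1 : (0 : ℝ) ≤ (n : ℝ) - 1 := by
    have : (2 : ℝ) ≤ n := by exact_mod_cast hn
    linarith
  have hsub : closedBall (0 : EuclideanSpace ℝ (Fin n)) r ⊆ ball 0 R := closedBall_subset_ball hrR
  have htsub : ball (0 : EuclideanSpace ℝ (Fin n)) t ⊆ closedBall 0 r :=
    ball_subset_closedBall.trans (closedBall_subset_closedBall htr.le)
  have hshell : MeasurableSet (closedBall (0 : EuclideanSpace ℝ (Fin n)) r \ ball 0 t) :=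
    measurableSet_closedBall.diff measurableSet_ball
  have hg0 : ∀ x ∈ ball (0 : EuclideanSpace ℝ (Fin n)) R, 0 ≤ logDensity f x := fun x hx =>
    logDensity_nonneg (hf1 x hx) (hJ x hx)
  have hgt := hg.mono_set htsub
  have hgs := hg.mono_set
    (sdiff_subset : closedBall (0 : EuclideanSpace ℝ (Fin n)) r \ ball 0 t ⊆ closedBall 0 r)
  have hα0 : 0 ≤ ((n : ℝ) - 1) / n := by positivity
  have hα1 : ((n : ℝ) - 1) / n ≤ 1 := div_le_one_of_le₀ (by linarith) (by positivity)
  have hpowi : IntegrableOn (fun x => K ^ ((1 : ℝ) / n) * logDensity f x ^ (((n : ℝ) - 1) / n))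
      (closedBall (0 : EuclideanSpace ℝ (Fin n)) r \ ball 0 t) := by
    refine Integrable.const_mul ?_ _
    have hfin : IntegrableOn (fun _ => (1 : ℝ))
        (closedBall (0 : EuclideanSpace ℝ (Fin n)) r \ ball 0 t) :=
      integrableOn_const (measure_ne_top_of_subset sdiff_subset measure_closedBall_lt_top.ne)
    refine (hfin.add hgs).mono' ?_ ?_
    · exact (Real.continuous_rpow_const hα0).comp_aestronglyMeasurable hgs.aestronglyMeasurable
    · refine (ae_restrict_iff' hshell).2 (Filter.Eventually.of_forall fun x hx => ?_)
      have h0 := hg0 x (hsub hx.1)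
      rw [Real.norm_of_nonneg (Real.rpow_nonneg h0 _)]
      simp only [Pi.add_apply]
      rcases le_total (logDensity f x) 1 with h | h
      · linarith [Real.rpow_le_one h0 h hα0]
      · have := Real.rpow_le_rpow_of_exponent_le h hα1
        rw [Real.rpow_one] at this
        linarith
  set P := ∫ x in closedBall (0 : EuclideanSpace ℝ (Fin n)) r \ ball 0 t,
        K ^ ((1 : ℝ) / n) * logDensity f x ^ (((n : ℝ) - 1) / n) with hP
  have hθm : ∀ δ : ℝ, AEStronglyMeasurable
      (fun x => Real.smoothTransition (‖f x‖ ^ 2 / δ - 1) * (2 * ((n : ℝ) - 1) * logDensity f x))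
      (volume.restrict (ball (0 : EuclideanSpace ℝ (Fin n)) t)) := by
    intro δ
    refine AEStronglyMeasurable.mul ?_ (hgt.aestronglyMeasurable.const_mul _)
    refine Real.smoothTransition.continuous.comp_aestronglyMeasurable ?_
    refine ContinuousOn.aestronglyMeasurable ?_ measurableSet_ball
    intro x hx
    have := (hf x (hsub (htsub hx))).continuousAt.continuousWithinAt (s := ball 0 t)
    exact ((this.norm.pow 2).div_const δ).sub continuousWithinAt_const
  have hbound : ∀ δ : ℝ, ∀ x ∈ ball (0 : EuclideanSpace ℝ (Fin n)) t,
      ‖Real.smoothTransition (‖f x‖ ^ 2 / δ - 1) * (2 * ((n : ℝ) - 1) * logDensity f x)‖ ≤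
        2 * ((n : ℝ) - 1) * logDensity f x := by
    intro δ x hx
    have h0 : 0 ≤ 2 * ((n : ℝ) - 1) * logDensity f x :=
      mul_nonneg (by positivity) (hg0 x (hsub (htsub hx)))
    rw [Real.norm_of_nonneg (mul_nonneg (Real.smoothTransition.nonneg _) h0)]
    exact mul_le_of_le_one_left h0 (Real.smoothTransition.le_one _)
  have hθi : ∀ δ : ℝ, IntegrableOn
      (fun x => Real.smoothTransition (‖f x‖ ^ 2 / δ - 1) * (2 * ((n : ℝ) - 1) * logDensity f x))
      (ball (0 : EuclideanSpace ℝ (Fin n)) t) := fun δ =>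
    (hgt.const_mul (2 * ((n : ℝ) - 1))).mono' (hθm δ)
      ((ae_restrict_iff' measurableSet_ball).2 (Filter.Eventually.of_forall (hbound δ)))
  have key : ∀ δ : ℝ, 0 < δ → ∀ h : ℝ, 0 < h → h < r - t →
      (∫ x in ball (0 : EuclideanSpace ℝ (Fin n)) t, Real.smoothTransition (‖f x‖ ^ 2 / δ - 1) *
        (2 * ((n : ℝ) - 1) * logDensity f x)) ≤ 1 / h * P := by
    intro δ hδ h hh hhr
    obtain ⟨i1, i2, i3⟩ := integral_divergence_le_shell ht hrR hh hhr hf hf1 hJ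
      (a := logProfile n δ) (fun s hs => contDiffAt_logProfile n hδ hs)
      (fun s hs0 hs => divergence_logProfile_nonneg hn hδ hs0 hs)
    refine le_trans (setIntegral_mono_on (hθi δ) i1 measurableSet_ball fun x hx => ?_)
      (i3.trans (mul_le_mul_of_nonneg_left (integral_mono_ae i2 hpowi ?_) (by positivity)))
    · have hx' := hsub (htsub hx)
      exact smoothTransition_mul_le hn hδ (norm_nonneg _) (hf1 x hx') (hJ x hx')
    · have hc := ae_restrict_of_ae_restrict_of_subset (sdiff_subset.trans hsub :
        closedBall (0 : EuclideanSpace ℝ (Fin n)) r \ ball 0 t ⊆ ball 0 R) hcof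
      filter_upwards [hc, ae_restrict_mem hshell] with x hx hxs
      exact mul_logProfile_le hn (norm_nonneg _) (hf1 x (hsub hxs.1)) (norm_nonneg _)
        (hJ x (hsub hxs.1)) hK hx
  have key2 : ∀ δ : ℝ, 0 < δ →
      (∫ x in ball (0 : EuclideanSpace ℝ (Fin n)) t, Real.smoothTransition (‖f x‖ ^ 2 / δ - 1) *
        (2 * ((n : ℝ) - 1) * logDensity f x)) ≤ 1 / (r - t) * P := by
    intro δ hδ
    have hlim : Filter.Tendsto (fun h : ℝ => 1 / h * P) (𝓝[<] (r - t)) (𝓝 (1 / (r - t) * P)) := by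
      have : ContinuousAt (fun h : ℝ => 1 / h * P) (r - t) :=
        (continuousAt_const.div continuousAt_id (by simp only [id]; linarith)).mul
          continuousAt_const
      exact this.tendsto.mono_left nhdsWithin_le_nhds
    refine ge_of_tendsto hlim ?_
    filter_upwards [Ioo_mem_nhdsLT (show (0 : ℝ) < r - t by linarith)] with h hh
    exact key δ hδ h hh.1 hh.2
  have hlim : Filter.Tendsto (fun k : ℕ => ∫ x in ball (0 : EuclideanSpace ℝ (Fin n)) t,
      Real.smoothTransition (‖f x‖ ^ 2 / (1 / ((k : ℝ) + 1)) - 1) *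
        (2 * ((n : ℝ) - 1) * logDensity f x)) Filter.atTop
      (𝓝 (∫ x in ball (0 : EuclideanSpace ℝ (Fin n)) t, 2 * ((n : ℝ) - 1) * logDensity f x)) := by
    refine tendsto_integral_of_dominated_convergence _ (fun k => hθm _)
      (hgt.const_mul (2 * ((n : ℝ) - 1))) (fun k => (ae_restrict_iff' measurableSet_ball).2
        (Filter.Eventually.of_forall (hbound _))) ?_
    refine Filter.Eventually.of_forall fun x => ?_
    by_cases hx : f x = 0
    · simp [logDensity_eq_zero (by omega) hx]
    · refine tendsto_const_nhds.congr' ?_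
      have h0 : 0 < ‖f x‖ ^ 2 := by positivity
      obtain ⟨k0, hk0⟩ := exists_nat_gt (2 / ‖f x‖ ^ 2)
      filter_upwards [Filter.eventually_ge_atTop k0] with k hk
      rw [Real.smoothTransition.one_of_one_le, one_mul]
      have : (k0 : ℝ) ≤ k := by exact_mod_cast hk
      rw [div_lt_iff₀ h0] at hk0
      rw [div_div_eq_mul_div, div_one]
      nlinarith
  rw [← integral_const_mul]
  exact le_of_tendsto' hlim fun k => key2 _ (by positivity)

lemma integral_rpow_le_rpow_integral {X : Type*} [MeasurableSpace X] {μ : Measure X}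
    [IsFiniteMeasure μ] {g : X → ℝ} {α : ℝ} (hα0 : 0 < α) (hα1 : α < 1) (hg0 : 0 ≤ᵐ[μ] g)
    (hg : Integrable g μ) :
    ∫ x, g x ^ α ∂μ ≤ (∫ x, g x ∂μ) ^ α * μ.real univ ^ (1 - α) := by
  have hpq : (1 / α).HolderConjugate (1 / (1 - α)) := by
    rw [Real.holderConjugate_iff]
    constructor
    · rw [lt_div_iff₀ hα0]; linarith
    · simp
  have hmem : MemLp (fun x => g x ^ α) (ENNReal.ofReal (1 / α)) μ := by
    have h1 : MemLp g 1 μ := memLp_one_iff_integrable.2 hg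
    have h2 := h1.norm_rpow_div (ENNReal.ofReal α)
    rw [ENNReal.toReal_ofReal hα0.le, ← ENNReal.ofReal_one,
      ← ENNReal.ofReal_div_of_pos hα0] at h2
    refine h2.ae_eq ?_
    filter_upwards [hg0] with x hx
    rw [Real.norm_of_nonneg hx]
  have h := integral_mul_le_Lp_mul_Lq_of_nonneg hpq (μ := μ) (f := fun x => g x ^ α)
    (g := fun _ => (1 : ℝ)) (hg0.mono fun x hx => Real.rpow_nonneg hx _)
    (Filter.Eventually.of_forall fun _ => zero_le_one) hmem (memLp_const 1)
  simp only [mul_one, Real.one_rpow, integral_const, smul_eq_mul, one_div_one_div] at h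
  refine h.trans (le_of_eq ?_)
  congr 2
  refine integral_congr_ae ?_
  filter_upwards [hg0] with x hx
  rw [← Real.rpow_mul hx, mul_one_div_cancel hα0.ne', Real.rpow_one]

/-- The shell form of the isoperimetric inequality. -/
lemma integral_logDensity_le_shell_rpow {n : ℕ} (hn : 2 ≤ n)
    {f : EuclideanSpace ℝ (Fin n) → EuclideanSpace ℝ (Fin n)} {t r R K : ℝ}
    (ht : 0 < t) (htr : t < r) (hrR : r < R) (hK : 0 ≤ K)
    (hf : ∀ x ∈ ball (0 : EuclideanSpace ℝ (Fin n)) R, ContDiffAt ℝ 2 f x)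
    (hf1 : ∀ x ∈ ball (0 : EuclideanSpace ℝ (Fin n)) R, ‖f x‖ ^ 2 < 1)
    (hJ : ∀ x ∈ ball (0 : EuclideanSpace ℝ (Fin n)) R, 0 ≤ (jacobianMatrix f x).det)
    (hcof : ∀ᵐ x ∂(volume.restrict (ball (0 : EuclideanSpace ℝ (Fin n)) R)),
      matOpNorm (cofMatrix (jacobianMatrix f x)) ^ n ≤ K * (jacobianMatrix f x).det ^ (n - 1))
    (hg : IntegrableOn (logDensity f) (closedBall 0 r)) :
    2 * ((n : ℝ) - 1) * ∫ x in ball (0 : EuclideanSpace ℝ (Fin n)) t, logDensity f x ≤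
      K ^ ((1 : ℝ) / n) *
        ((1 / (r - t) * ∫ x in closedBall (0 : EuclideanSpace ℝ (Fin n)) r \ ball 0 t,
          logDensity f x) ^ (((n : ℝ) - 1) / n) *
        (1 / (r - t) * volume.real (closedBall (0 : EuclideanSpace ℝ (Fin n)) r \ ball 0 t)) ^
          ((1 : ℝ) / n)) := by
  refine (integral_logDensity_le_shell hn ht htr hrR hK hf hf1 hJ hcof hg).trans ?_
  have hn2 : (2 : ℝ) ≤ n := by exact_mod_cast hn
  have hrt : 0 < r - t := by linarith
  have hshell : MeasurableSet (closedBall (0 : EuclideanSpace ℝ (Fin n)) r \ ball 0 t) :=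
    measurableSet_closedBall.diff measurableSet_ball
  have : IsFiniteMeasure (volume.restrict (closedBall (0 : EuclideanSpace ℝ (Fin n)) r \ ball 0 t)) :=
    isFiniteMeasure_restrict.2 (measure_ne_top_of_subset sdiff_subset measure_closedBall_lt_top.ne)
  have hg0 : 0 ≤ᵐ[volume.restrict (closedBall (0 : EuclideanSpace ℝ (Fin n)) r \ ball 0 t)]
      logDensity f := (ae_restrict_iff' hshell).2 (Filter.Eventually.of_forall fun x hx =>
    logDensity_nonneg (hf1 x (closedBall_subset_ball hrR hx.1))
      (hJ x (closedBall_subset_ball hrR hx.1)))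
  have h := integral_rpow_le_rpow_integral (α := ((n : ℝ) - 1) / n) (by
    apply div_pos <;> linarith) (by rw [div_lt_one] <;> linarith) hg0 (hg.mono_set sdiff_subset)
  have e : 1 - ((n : ℝ) - 1) / n = 1 / n := by field_simp; ring
  rw [e, measureReal_restrict_apply_univ] at h
  rw [integral_const_mul, Real.mul_rpow (by positivity) (integral_nonneg_of_ae hg0),
    Real.mul_rpow (by positivity) measureReal_nonneg]
  have e2 : 1 / (r - t) = (1 / (r - t)) ^ (((n : ℝ) - 1) / n) * (1 / (r - t)) ^ ((1 : ℝ) / n) := by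
    rw [← Real.rpow_add (by positivity), ← e]; simp
  have h3 := mul_le_mul_of_nonneg_left h
    (show 0 ≤ 1 / (r - t) * K ^ ((1 : ℝ) / n) by positivity)
  refine le_trans (le_of_eq (by ring)) (h3.trans (le_of_eq ?_))
  conv_lhs => rw [e2]
  ring

/-- Integration in polar coordinates. -/
lemma integral_polar {n : ℕ} (hn : n ≠ 0) {G : EuclideanSpace ℝ (Fin n) → ℝ} (hG : Integrable G) :
    IntegrableOn (fun s : ℝ => s ^ (n - 1) * ∫ ω, G (s • (ω : EuclideanSpace ℝ (Fin n)))
      ∂(volume : Measure (EuclideanSpace ℝ (Fin n))).toSphere) (Ioi 0) ∧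
    ∫ x, G x = ∫ s in Ioi (0 : ℝ), s ^ (n - 1) * ∫ ω, G (s • (ω : EuclideanSpace ℝ (Fin n)))
      ∂(volume : Measure (EuclideanSpace ℝ (Fin n))).toSphere ∧
    ∀ᵐ s ∂(volume.restrict (Ioi (0 : ℝ))), Integrable (fun ω : sphere (0 : EuclideanSpace ℝ (Fin n)) 1 =>
      G (s • (ω : EuclideanSpace ℝ (Fin n)))) (volume : Measure (EuclideanSpace ℝ (Fin n))).toSphere := by
  let E := EuclideanSpace ℝ (Fin n)
  let σ := (volume : Measure E).toSphere
  let ν := Measure.volumeIoiPow (n - 1)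
  have hfr : Module.finrank ℝ E = n := by simp [E]
  have : Nonempty (Fin n) := ⟨⟨0, by omega⟩⟩
  let H : sphere (0 : E) 1 × Ioi (0 : ℝ) → ℝ := fun p => G (p.2.1 • (p.1 : E))
  have hmp := (volume : Measure E).measurePreserving_homeomorphUnitSphereProd
  rw [hfr] at hmp
  have hHcomp : ∀ x : ({0}ᶜ : Set E), H (homeomorphUnitSphereProd E x) = G x := by
    intro x
    have h0 : ‖(x : E)‖ ≠ 0 := norm_ne_zero_iff.2 x.2
    simp only [H]
    congr 1
    rw [homeomorphUnitSphereProd_apply_snd_coe, homeomorphUnitSphereProd_apply_fst_coe, smul_smul,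
      mul_inv_cancel₀ h0, one_smul]
  have hcompl : MeasurableSet ({0}ᶜ : Set E) := (measurableSet_singleton _).compl
  have hHi : Integrable H (σ.prod ν) := by
    rw [← hmp.integrable_comp_emb (Homeomorph.measurableEmbedding _)]
    have : H ∘ homeomorphUnitSphereProd E = fun x : ({0}ᶜ : Set E) => G x := funext hHcomp
    rw [this]
    exact (integrableOn_iff_comap_subtypeVal hcompl).1 hG.integrableOn
  have hHint : ∫ x, G x = ∫ p, H p ∂(σ.prod ν) := by
    rw [← hmp.integral_comp (Homeomorph.measurableEmbedding _)]
    simp only [hHcomp]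
    rw [integral_subtype_comap hcompl G, restrict_compl_singleton]
  have hmeas : Measurable fun r : Ioi (0 : ℝ) => Real.toNNReal (r.1 ^ (n - 1)) :=
    (measurable_subtype_coe.pow_const _).real_toNNReal
  have hν : ν = (Measure.comap Subtype.val volume).withDensity
      fun r : Ioi (0 : ℝ) => ((Real.toNNReal (r.1 ^ (n - 1)) : ℝ≥0) : ℝ≥0∞) := rfl
  have hsm : ∀ (r : Ioi (0 : ℝ)) (y : ℝ), Real.toNNReal (r.1 ^ (n - 1)) • y = r.1 ^ (n - 1) * y := by
    intro r y
    rw [NNReal.smul_def, Real.coe_toNNReal _ (pow_nonneg (le_of_lt r.2) _), smul_eq_mul]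
  refine ⟨?_, ?_, ?_⟩
  · have h := hHi.integral_prod_right
    rw [hν, integrable_withDensity_iff_integrable_smul hmeas] at h
    simp only [hsm] at h
    rw [integrableOn_iff_comap_subtypeVal measurableSet_Ioi]
    exact h
  · rw [hHint, integral_prod_symm _ hHi, hν, integral_withDensity_eq_integral_smul hmeas]
    simp only [hsm]
    exact integral_subtype_comap measurableSet_Ioi
      (fun s : ℝ => s ^ (n - 1) * ∫ ω, G (s • (ω : EuclideanSpace ℝ (Fin n))) ∂σ)
  · have h := hHi.prod_left_ae
    rw [hν, ae_withDensity_iff hmeas.coe_nnreal_ennreal] at h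
    rw [← map_comap_subtype_coe measurableSet_Ioi,
      (MeasurableEmbedding.subtype_coe measurableSet_Ioi).ae_map_iff]
    filter_upwards [h] with s hs
    refine hs ?_
    have : (0 : ℝ) < s.1 ^ (n - 1) := pow_pos s.2 _
    simpa using this

/-- Integration in polar coordinates over a radial set. -/
lemma setIntegral_polar {n : ℕ} (hn : n ≠ 0) {g : EuclideanSpace ℝ (Fin n) → ℝ} {A : Set ℝ}
    (hA : MeasurableSet A) (hA0 : A ⊆ Ioi 0)
    (hg : IntegrableOn g {x : EuclideanSpace ℝ (Fin n) | ‖x‖ ∈ A}) :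
    IntegrableOn (fun s : ℝ => s ^ (n - 1) * ∫ ω, g (s • (ω : EuclideanSpace ℝ (Fin n)))
      ∂(volume : Measure (EuclideanSpace ℝ (Fin n))).toSphere) A ∧
    ∫ x in {x : EuclideanSpace ℝ (Fin n) | ‖x‖ ∈ A}, g x =
      ∫ s in A, s ^ (n - 1) * ∫ ω, g (s • (ω : EuclideanSpace ℝ (Fin n)))
      ∂(volume : Measure (EuclideanSpace ℝ (Fin n))).toSphere ∧
    ∀ᵐ s ∂(volume.restrict A), Integrable (fun ω : sphere (0 : EuclideanSpace ℝ (Fin n)) 1 =>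
      g (s • (ω : EuclideanSpace ℝ (Fin n)))) (volume : Measure (EuclideanSpace ℝ (Fin n))).toSphere := by
  have hB : MeasurableSet {x : EuclideanSpace ℝ (Fin n) | ‖x‖ ∈ A} := measurable_norm hA
  obtain ⟨h1, h2, h3⟩ := integral_polar hn ((integrable_indicator_iff hB).2 hg)
  have hmem : ∀ s ∈ Ioi (0 : ℝ), ∀ ω : sphere (0 : EuclideanSpace ℝ (Fin n)) 1,
      (s • (ω : EuclideanSpace ℝ (Fin n)) ∈ {x : EuclideanSpace ℝ (Fin n) | ‖x‖ ∈ A} ↔ s ∈ A) := by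
    intro s hs ω
    have : ‖s • (ω : EuclideanSpace ℝ (Fin n))‖ = s := by
      rw [norm_smul, mem_sphere_zero_iff_norm.1 ω.2, mul_one, Real.norm_of_nonneg (le_of_lt hs)]
    simp only [mem_ofPred_eq, this]
  have hind : ∀ s ∈ Ioi (0 : ℝ),
      (s ^ (n - 1) * ∫ ω : sphere (0 : EuclideanSpace ℝ (Fin n)) 1,
        {x : EuclideanSpace ℝ (Fin n) | ‖x‖ ∈ A}.indicator g (s • (ω : EuclideanSpace ℝ (Fin n)))
        ∂(volume : Measure (EuclideanSpace ℝ (Fin n))).toSphere) =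
      A.indicator (fun s : ℝ => s ^ (n - 1) * ∫ ω, g (s • (ω : EuclideanSpace ℝ (Fin n)))
        ∂(volume : Measure (EuclideanSpace ℝ (Fin n))).toSphere) s := by
    intro s hs
    by_cases hsA : s ∈ A
    · rw [indicator_of_mem hsA]
      congr 2
      funext ω
      rw [indicator_of_mem ((hmem s hs ω).2 hsA)]
    · rw [indicator_of_notMem hsA]
      have : (fun ω : sphere (0 : EuclideanSpace ℝ (Fin n)) 1 =>
          {x : EuclideanSpace ℝ (Fin n) | ‖x‖ ∈ A}.indicator g
            (s • (ω : EuclideanSpace ℝ (Fin n)))) = fun _ => 0 := by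
        funext ω
        rw [indicator_of_notMem fun h => hsA ((hmem s hs ω).1 h)]
      rw [this]
      simp
  refine ⟨?_, ?_, ?_⟩
  · rw [integrableOn_congr_fun hind measurableSet_Ioi] at h1
    have h4 := (integrableOn_indicator_iff hA).1 h1
    rwa [inter_eq_self_of_subset_left hA0] at h4
  · rw [integral_indicator hB, setIntegral_congr_fun measurableSet_Ioi hind,
      setIntegral_indicator hA, inter_eq_self_of_subset_right hA0] at h2
    exact h2
  · filter_upwards [ae_restrict_of_ae_restrict_of_subset hA0 h3, ae_restrict_mem hA] with s hs hsA
    refine hs.congr (Filter.Eventually.of_forall fun ω => ?_)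
    exact indicator_of_mem ((hmem s (hA0 hsA) ω).2 hsA) _

lemma tendsto_shell_average {n : ℕ} (hn : n ≠ 0) {g : EuclideanSpace ℝ (Fin n) → ℝ} {q : ℝ}
    (hg : IntegrableOn g (ball (0 : EuclideanSpace ℝ (Fin n)) q)) :
    ∀ᵐ t ∂(volume.restrict (Ioo 0 q)),
      Integrable (fun ω : sphere (0 : EuclideanSpace ℝ (Fin n)) 1 =>
        g (t • (ω : EuclideanSpace ℝ (Fin n))))
        (volume : Measure (EuclideanSpace ℝ (Fin n))).toSphere ∧
      Filter.Tendsto (fun r => 1 / (r - t) *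
        ∫ x in closedBall (0 : EuclideanSpace ℝ (Fin n)) r \ ball 0 t, g x) (𝓝[>] t)
        (𝓝 (t ^ (n - 1) * ∫ ω, g (t • (ω : EuclideanSpace ℝ (Fin n)))
          ∂(volume : Measure (EuclideanSpace ℝ (Fin n))).toSphere)) := by
  rcases le_or_gt q 0 with hq | hq
  · simp [Ioo_eq_empty_of_le hq]
  obtain ⟨h1, -, h3⟩ := setIntegral_polar hn (g := g) (A := Ioo 0 q) measurableSet_Ioo
    (fun s hs => hs.1) (hg.mono_set fun x hx => mem_ball_zero_iff.2 (mem_Ioo.1 hx).2)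
  have hii : IntervalIntegrable (fun s : ℝ => s ^ (n - 1) * ∫ ω, g (s • (ω : EuclideanSpace ℝ (Fin n)))
      ∂(volume : Measure (EuclideanSpace ℝ (Fin n))).toSphere) volume 0 q := by
    rw [intervalIntegrable_iff_integrableOn_Ioo_of_le hq.le]
    exact h1
  have hd := ae_restrict_of_ae (s := Ioo 0 q) hii.ae_hasDerivAt_integral
  filter_upwards [h3, hd, ae_restrict_mem measurableSet_Ioo] with t ht3 htd ht
  refine ⟨ht3, ?_⟩
  have htu : t ∈ uIcc 0 q := by
    rw [uIcc_of_le hq.le]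
    exact Ioo_subset_Icc_self ht
  have h := (hasDerivAt_iff_tendsto_slope.1 (htd htu t htu)).mono_left
    (nhdsWithin_mono t (fun r (hr : t < r) => ne_of_gt hr))
  refine h.congr' ?_
  filter_upwards [Ioo_mem_nhdsGT ht.2] with r hr
  have hset : closedBall (0 : EuclideanSpace ℝ (Fin n)) r \ ball 0 t =
      {x : EuclideanSpace ℝ (Fin n) | ‖x‖ ∈ Icc t r} := by
    ext x
    simp [and_comm]
  obtain ⟨-, h2, -⟩ := setIntegral_polar hn (g := g) (A := Icc t r) measurableSet_Icc
    (fun s hs => ht.1.trans_le hs.1)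
    (hg.mono_set fun x hx => mem_ball_zero_iff.2 ((mem_Icc.1 hx).2.trans_lt hr.2))
  rw [hset, h2, slope_def_field, intervalIntegral.integral_same, sub_zero,
    intervalIntegral.integral_of_le hr.1.le, integral_Icc_eq_integral_Ioc]
  ring

/-- The isoperimetric inequality on almost every sphere, in polar coordinates. -/
lemma integral_logDensity_le_toSphere {n : ℕ} (hn : 2 ≤ n)
    {f : EuclideanSpace ℝ (Fin n) → EuclideanSpace ℝ (Fin n)} {q R K : ℝ}
    (hqR : q ≤ R) (hK : 0 ≤ K)
    (hf : ∀ x ∈ ball (0 : EuclideanSpace ℝ (Fin n)) R, ContDiffAt ℝ 2 f x)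
    (hf1 : ∀ x ∈ ball (0 : EuclideanSpace ℝ (Fin n)) R, ‖f x‖ ^ 2 < 1)
    (hJ : ∀ x ∈ ball (0 : EuclideanSpace ℝ (Fin n)) R, 0 ≤ (jacobianMatrix f x).det)
    (hcof : ∀ᵐ x ∂(volume.restrict (ball (0 : EuclideanSpace ℝ (Fin n)) R)),
      matOpNorm (cofMatrix (jacobianMatrix f x)) ^ n ≤ K * (jacobianMatrix f x).det ^ (n - 1))
    (hg : IntegrableOn (logDensity f) (ball 0 q)) :
    ∀ᵐ t ∂(volume.restrict (Ioo 0 q)),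
    Integrable (fun ω : sphere (0 : EuclideanSpace ℝ (Fin n)) 1 =>
        logDensity f (t • (ω : EuclideanSpace ℝ (Fin n))))
        (volume : Measure (EuclideanSpace ℝ (Fin n))).toSphere ∧
    2 * ((n : ℝ) - 1) * ∫ x in ball (0 : EuclideanSpace ℝ (Fin n)) t, logDensity f x ≤
      K ^ ((1 : ℝ) / n) *
        ((t ^ (n - 1) * ∫ ω, logDensity f (t • (ω : EuclideanSpace ℝ (Fin n)))
          ∂(volume : Measure (EuclideanSpace ℝ (Fin n))).toSphere) ^ (((n : ℝ) - 1) / n) *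
        (t ^ (n - 1) * (volume : Measure (EuclideanSpace ℝ (Fin n))).toSphere.real univ) ^
          ((1 : ℝ) / n)) := by
  have hn2 : (2 : ℝ) ≤ n := by exact_mod_cast hn
  have hone : IntegrableOn (fun _ => (1 : ℝ)) (ball (0 : EuclideanSpace ℝ (Fin n)) q) :=
    integrableOn_const measure_ball_lt_top.ne
  filter_upwards [tendsto_shell_average (by omega) hg, tendsto_shell_average (by omega) hone,
    ae_restrict_mem measurableSet_Ioo] with t ht1 ht2 ht
  refine ⟨ht1.1, ?_⟩
  have h2 := ht2.2
  simp only [integral_const, smul_eq_mul, mul_one, measureReal_restrict_apply_univ] at h2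
  have hlim := ((ht1.2.rpow_const (p := ((n : ℝ) - 1) / n) (Or.inr (by
    apply div_nonneg <;> linarith))).mul (h2.rpow_const (p := (1 : ℝ) / n)
    (Or.inr (by positivity)))).const_mul (K ^ ((1 : ℝ) / n))
  refine ge_of_tendsto hlim ?_
  filter_upwards [Ioo_mem_nhdsGT ht.2] with r hr
  exact integral_logDensity_le_shell_rpow hn ht.1 hr.1 (hr.2.trans_le hqR) hK hf hf1 hJ hcof
    (hg.mono_set (closedBall_subset_ball hr.2))

open scoped Pointwise in
/-- The volume of the shell between a cone over a small subset of the unit sphere and a slight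
dilation of that cone. -/
lemma volume_smul_cone_sdiff_le {n : ℕ} {B : Set (EuclideanSpace ℝ (Fin n))}
    (hB : B ⊆ sphere 0 1) {δ h : ℝ} (hδ : 0 ≤ δ) (hδ1 : δ ≤ 1) (hh : 0 < h)
    (hd : ∀ x ∈ B, ∀ y ∈ B, dist x y ≤ δ) :
    volume (((1 + h) • (Ioo (0 : ℝ) 1 • B)) \ (Ioo (0 : ℝ) 1 • B)) ≤
      ENNReal.ofReal (h + δ ^ 2 / 2) * ENNReal.ofReal (δ * (1 + 2 * h)) ^ (n - 1) := by
  rcases B.eq_empty_or_nonempty with rfl | ⟨x₀, hx₀⟩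
  · simp
  have hx₀1 : ‖x₀‖ = 1 := mem_sphere_zero_iff_norm.1 (hB hx₀)
  have hn : 0 < n := by
    rcases Nat.eq_zero_or_pos n with rfl | h
    · rw [Subsingleton.elim x₀ 0, norm_zero] at hx₀1
      exact absurd hx₀1 (by norm_num)
    · exact h
  let i₀ : Fin n := ⟨0, hn⟩
  obtain ⟨b, hb⟩ := Orthonormal.exists_orthonormalBasis_extension_of_card_eq (𝕜 := ℝ)
    (E := EuclideanSpace ℝ (Fin n)) (ι := Fin n) (by simp) (v := fun _ => x₀) (s := {i₀})
    (by
      rw [orthonormal_iff_ite]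
      rintro ⟨i, hi⟩ ⟨j, hj⟩
      obtain rfl : i = i₀ := hi
      obtain rfl : j = i₀ := hj
      simp [hx₀1])
  have hb0 : b i₀ = x₀ := hb i₀ rfl
  set D := ((1 + h) • (Ioo (0 : ℝ) 1 • B)) \ (Ioo (0 : ℝ) 1 • B) with hD
  have hDmem : ∀ y ∈ D, ∃ ρ : ℝ, ∃ a ∈ B, 1 ≤ ρ ∧ ρ ≤ 1 + h ∧ y = ρ • a := by
    rintro y ⟨⟨z, ⟨s, hs, a, ha, rfl⟩, rfl⟩, hy⟩
    refine ⟨(1 + h) * s, a, ha, ?_, ?_, by simp [smul_smul]⟩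
    · by_contra hlt
      push Not at hlt
      refine hy ⟨(1 + h) * s, ⟨by have := hs.1; positivity, hlt⟩, a, ha, by simp [smul_smul]⟩
    · have := hs.2
      nlinarith
  let Φ : EuclideanSpace ℝ (Fin n) ≃ᵐ (Fin n → ℝ) :=
    b.measurableEquiv.trans (MeasurableEquiv.toLp 2 (Fin n → ℝ)).symm
  have hΦ : MeasurePreserving Φ volume volume :=
    b.measurePreserving_measurableEquiv.trans (PiLp.volume_preserving_ofLp (Fin n))
  have hΦa : ∀ y i, Φ y i = inner ℝ (b i) y := fun y i => b.repr_apply_apply y i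
  have hvol : volume D = volume (Φ '' D) := by
    rw [← hΦ.measure_preimage_equiv, preimage_image_eq _ Φ.injective]
  rw [hvol]
  refine (Real.volume_pi_le_prod_diam _).trans ?_
  have hcoord : ∀ i, ∀ w : ℝ, (∀ y ∈ D, ∀ y' ∈ D, |inner ℝ (b i) y - inner ℝ (b i) y'| ≤ w) →
      ediam (Function.eval i '' (Φ '' D)) ≤ ENNReal.ofReal w := by
    intro i w hw
    refine Metric.ediam_le ?_
    rintro _ ⟨_, ⟨y, hy, rfl⟩, rfl⟩ _ ⟨_, ⟨y', hy', rfl⟩, rfl⟩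
    rw [edist_dist]
    refine ENNReal.ofReal_le_ofReal ?_
    simp only [Function.eval, hΦa, Real.dist_eq]
    exact hw y hy y' hy'
  rw [← Finset.mul_prod_erase _ _ (Finset.mem_univ i₀)]
  refine mul_le_mul' (hcoord i₀ _ ?_) ?_
  · have hbd : ∀ y ∈ D, 1 - δ ^ 2 / 2 ≤ inner ℝ (b i₀) y ∧ inner ℝ (b i₀) y ≤ 1 + h := by
      intro y hy
      obtain ⟨ρ, a, ha, h1, h2, rfl⟩ := hDmem y hy
      have ha1 : ‖a‖ = 1 := mem_sphere_zero_iff_norm.1 (hB ha)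
      rw [hb0, real_inner_smul_right]
      have e1 : inner ℝ x₀ a ≤ 1 := by
        have := real_inner_le_norm x₀ a
        rwa [hx₀1, ha1, mul_one] at this
      have e2 : 1 - δ ^ 2 / 2 ≤ inner ℝ x₀ a := by
        have h3 := norm_sub_sq_real x₀ a
        rw [hx₀1, ha1] at h3
        have h4 := hd x₀ hx₀ a ha
        rw [dist_eq_norm] at h4
        have h5 := pow_le_pow_left₀ (norm_nonneg _) h4 2
        linarith
      have e0 : 0 ≤ inner ℝ x₀ a := by nlinarith
      constructor
      · nlinarith
      · nlinarith
    intro y hy y' hy'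
    have := hbd y hy
    have := hbd y' hy'
    rw [abs_le]
    constructor <;> linarith
  · have hle : ∀ i ∈ Finset.univ.erase i₀, ediam (Function.eval i '' (Φ '' D)) ≤
        ENNReal.ofReal (δ * (1 + 2 * h)) := by
      intro i hi
      refine hcoord i _ ?_
      have hi0 : inner ℝ (b i) x₀ = 0 := by
        rw [← hb0]
        exact b.orthonormal.2 (Finset.ne_of_mem_erase hi)
      have hsub : ∀ a ∈ B, ∀ a' ∈ B, |inner ℝ (b i) a - inner ℝ (b i) a'| ≤ δ := by
        intro a ha a' ha'
        rw [← inner_sub_right]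
        refine (abs_real_inner_le_norm _ _).trans ?_
        rw [b.orthonormal.1 i, one_mul, ← dist_eq_norm]
        exact hd a ha a' ha'
      intro y hy y' hy'
      obtain ⟨ρ, a, ha, h1, h2, rfl⟩ := hDmem y hy
      obtain ⟨ρ', a', ha', h1', h2', rfl⟩ := hDmem y' hy'
      rw [real_inner_smul_right, real_inner_smul_right]
      have k1 := hsub a ha a' ha'
      have k2 := hsub a ha x₀ hx₀
      have k3 := hsub a' ha' x₀ hx₀
      rw [hi0, sub_zero] at k2 k3
      have k4 : |ρ * inner ℝ (b i) a - ρ' * inner ℝ (b i) a'| ≤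
          |inner ℝ (b i) a - inner ℝ (b i) a'| + (ρ - 1) * |inner ℝ (b i) a| +
            (ρ' - 1) * |inner ℝ (b i) a'| := by
        have : ρ * inner ℝ (b i) a - ρ' * inner ℝ (b i) a' =
          (inner ℝ (b i) a - inner ℝ (b i) a') + (ρ - 1) * inner ℝ (b i) a -
            (ρ' - 1) * inner ℝ (b i) a' := by ring
        rw [this]
        refine (abs_sub _ _).trans (add_le_add ((abs_add_le _ _).trans (add_le_add le_rfl ?_)) ?_)
        · rw [abs_mul, abs_of_nonneg (by linarith)]
        · rw [abs_mul, abs_of_nonneg (by linarith)]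
      have k5 : (ρ - 1) * |inner ℝ (b i) a| ≤ h * δ :=
        mul_le_mul (by linarith) k2 (abs_nonneg _) hh.le
      have k6 : (ρ' - 1) * |inner ℝ (b i) a'| ≤ h * δ :=
        mul_le_mul (by linarith) k3 (abs_nonneg _) hh.le
      linarith
    refine (Finset.prod_le_prod' hle).trans ?_
    rw [Finset.prod_const, Finset.card_erase_of_mem (Finset.mem_univ _), Finset.card_univ,
      Fintype.card_fin]

open scoped Pointwise in
lemma mul_volume_cone_le {n : ℕ} {B : Set (EuclideanSpace ℝ (Fin n))}
    (hB : B ⊆ sphere 0 1) {δ h : ℝ} (hδ : 0 ≤ δ) (hδ1 : δ ≤ 1) (hh : 0 < h)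
    (hd : ∀ x ∈ B, ∀ y ∈ B, dist x y ≤ δ) :
    ENNReal.ofReal h * (n * volume (Ioo (0 : ℝ) 1 • B)) ≤
      ENNReal.ofReal (h + δ ^ 2 / 2) * ENNReal.ofReal (δ * (1 + 2 * h)) ^ (n - 1) := by
  refine le_trans ?_ ((le_measure_sdiff).trans (volume_smul_cone_sdiff_le hB hδ hδ1 hh hd))
  have hfin : volume (Ioo (0 : ℝ) 1 • B) ≠ ∞ := by
    refine measure_ne_top_of_subset ?_ (measure_ball_lt_top (x := (0 : EuclideanSpace ℝ (Fin n)))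
      (r := 1)).ne
    rintro _ ⟨s, hs, a, ha, rfl⟩
    have ha1 : ‖a‖ = 1 := mem_sphere_zero_iff_norm.1 (hB ha)
    rw [mem_ball_zero_iff, norm_smul, ha1, mul_one, Real.norm_of_nonneg hs.1.le]
    exact hs.2
  rw [Measure.addHaar_smul, finrank_euclideanSpace, Fintype.card_fin, abs_of_nonneg (by positivity)]
  refine ENNReal.le_sub_of_add_le_right hfin ?_
  rw [← mul_assoc, ← ENNReal.ofReal_natCast, ← ENNReal.ofReal_mul hh.le]
  nth_rw 2 [← one_mul (volume _)]
  rw [← add_mul, ← ENNReal.ofReal_one, ← ENNReal.ofReal_add (by positivity) zero_le_one]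
  refine mul_le_mul' (ENNReal.ofReal_le_ofReal ?_) le_rfl
  have := one_add_mul_le_pow (a := h) (by linarith) n
  linarith

lemma toSphere_le_of_dist_le {n : ℕ} (hn : 2 ≤ n) {A : Set (sphere (0 : EuclideanSpace ℝ (Fin n)) 1)}
    (hA : MeasurableSet A) {δ : ℝ} (hδ : 0 ≤ δ) (hδ1 : δ ≤ 1)
    (hd : ∀ x ∈ A, ∀ y ∈ A, dist x y ≤ δ) :
    (volume : Measure (EuclideanSpace ℝ (Fin n))).toSphere A ≤
      ENNReal.ofReal ((1 + 2 * δ) ^ n) * ENNReal.ofReal δ ^ (n - 1) := by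
  rw [Measure.toSphere_apply' _ hA, finrank_euclideanSpace, Fintype.card_fin]
  have hB : ((↑) '' A : Set (EuclideanSpace ℝ (Fin n))) ⊆ sphere 0 1 := by
    rintro _ ⟨x, -, rfl⟩
    exact x.2
  have hd' : ∀ x ∈ ((↑) '' A : Set (EuclideanSpace ℝ (Fin n))), ∀ y ∈ ((↑) '' A :
      Set (EuclideanSpace ℝ (Fin n))), dist x y ≤ δ := by
    rintro _ ⟨x, hx, rfl⟩ _ ⟨y, hy, rfl⟩
    exact hd x hx y hy
  rcases hδ.eq_or_lt with rfl | hδ0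
  · have h := mul_volume_cone_le hB le_rfl zero_le_one one_pos hd'
    rw [ENNReal.ofReal_one, one_mul, zero_mul, ENNReal.ofReal_zero, zero_pow (M₀ := ℝ≥0∞) (by omega),
      mul_zero (ENNReal.ofReal _)] at h
    exact h.trans zero_le
  · have h := mul_volume_cone_le hB hδ0.le hδ1 hδ0 hd'
    have hδ' : ENNReal.ofReal δ ≠ 0 := by simpa using hδ0
    rw [← ENNReal.mul_le_mul_iff_right hδ' ENNReal.ofReal_ne_top]
    refine h.trans ?_
    rw [← ENNReal.ofReal_pow (by positivity), ← ENNReal.ofReal_pow (by positivity),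
      ← ENNReal.ofReal_mul (by positivity), ← ENNReal.ofReal_mul (by positivity),
      ← ENNReal.ofReal_mul (by positivity)]
    refine ENNReal.ofReal_le_ofReal ?_
    obtain ⟨m, rfl⟩ : ∃ m, n = m + 1 := ⟨n - 1, by omega⟩
    rw [Nat.add_sub_cancel, mul_pow, pow_succ (1 + 2 * δ)]
    have h1 : δ + δ ^ 2 / 2 ≤ δ * (1 + 2 * δ) := by nlinarith
    calc (δ + δ ^ 2 / 2) * (δ ^ m * (1 + 2 * δ) ^ m)
        ≤ (δ * (1 + 2 * δ)) * (δ ^ m * (1 + 2 * δ) ^ m) :=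
          mul_le_mul_of_nonneg_right h1 (by positivity)
      _ = _ := by ring

/-- The cone measure on the unit sphere is bounded by the Hausdorff measure. -/
theorem toSphere_le_hausdorffMeasure {n : ℕ} (hn : 2 ≤ n) :
    (volume : Measure (EuclideanSpace ℝ (Fin n))).toSphere ≤ μH[(n : ℝ) - 1] := by
  set σ := (volume : Measure (EuclideanSpace ℝ (Fin n))).toSphere with hσ
  have key : ∀ ε : ℝ, 0 < ε → ε ≤ 1 →
      (ENNReal.ofReal ((1 + 2 * ε) ^ n))⁻¹ • σ ≤ μH[(n : ℝ) - 1] := by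
    intro ε hε hε1
    refine Measure.le_hausdorffMeasure _ _ (ENNReal.ofReal ε) (by simpa using hε) fun s hs => ?_
    have hcl : ediam (closure s) ≠ ∞ := by
      rw [ediam_closure]
      exact (hs.trans_lt ENNReal.ofReal_lt_top).ne
    set δ := (ediam s).toReal with hδ
    have hδe : ENNReal.ofReal δ = ediam s :=
      ENNReal.ofReal_toReal (hs.trans_lt ENNReal.ofReal_lt_top).ne
    have hδε : δ ≤ ε := ENNReal.toReal_le_of_le_ofReal hε.le hs
    have h1 := toSphere_le_of_dist_le hn (A := closure s) isClosed_closure.measurableSet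
      ENNReal.toReal_nonneg (hδε.trans hε1) (fun x hx y hy => by
        rw [dist_edist, ← ediam_closure]
        exact ENNReal.toReal_mono hcl (edist_le_ediam_of_mem hx hy))
    rw [← hδ, hδe] at h1
    have hexp : (n : ℝ) - 1 = ((n - 1 : ℕ) : ℝ) := by
      rw [Nat.cast_sub (by omega), Nat.cast_one]
    rw [hexp, ENNReal.rpow_natCast, Measure.smul_apply, smul_eq_mul]
    have hc0 : ENNReal.ofReal ((1 + 2 * ε) ^ n) ≠ 0 := by
      rw [Ne, ENNReal.ofReal_eq_zero, not_le]
      positivity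
    rw [ENNReal.inv_mul_le_iff hc0 ENNReal.ofReal_ne_top]
    refine (measure_mono subset_closure).trans (h1.trans (mul_le_mul' ?_ le_rfl))
    have hδ0 : 0 ≤ δ := ENNReal.toReal_nonneg
    exact ENNReal.ofReal_le_ofReal (pow_le_pow_left₀ (by positivity) (by linarith) n)
  rw [Measure.le_iff']
  intro s
  have hlim : Filter.Tendsto (fun ε : ℝ => (ENNReal.ofReal ((1 + 2 * ε) ^ n)) * μH[(n : ℝ) - 1] s)
      (𝓝[>] 0) (𝓝 (1 * μH[(n : ℝ) - 1] s)) := by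
    refine ENNReal.Tendsto.mul_const ?_ (Or.inl one_ne_zero)
    have : Filter.Tendsto (fun ε : ℝ => (ENNReal.ofReal ((1 + 2 * ε) ^ n))) (𝓝 0)
        (𝓝 (ENNReal.ofReal ((1 + 2 * 0) ^ n))) :=
      (ENNReal.continuous_ofReal.comp (by fun_prop)).tendsto (0 : ℝ)
    simp only [mul_zero, add_zero, one_pow, ENNReal.ofReal_one] at this
    exact this.mono_left nhdsWithin_le_nhds
  rw [one_mul] at hlim
  refine ge_of_tendsto hlim ?_
  filter_upwards [Ioo_mem_nhdsGT one_pos] with ε hε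
  have h := key ε hε.1 hε.2.le s
  rw [Measure.smul_apply, smul_eq_mul, ENNReal.inv_mul_le_iff _ ENNReal.ofReal_ne_top] at h
  · exact h
  · rw [Ne, ENNReal.ofReal_eq_zero, not_le]
    have := hε.1
    positivity

lemma norm_normalize_sub_le {E : Type*} [NormedAddCommGroup E] [NormedSpace ℝ E] {v w : E}
    (hv : 1 ≤ ‖v‖) (hw : w ≠ 0) : ‖‖v‖⁻¹ • v - ‖w‖⁻¹ • w‖ ≤ 2 * ‖v - w‖ := by
  have hv0 : 0 < ‖v‖ := by linarith
  have hw0 : 0 < ‖w‖ := norm_pos_iff.2 hw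
  have e : ‖v‖⁻¹ • v - ‖w‖⁻¹ • w = ‖v‖⁻¹ • (v - w) + (‖v‖⁻¹ * ‖w‖⁻¹ * (‖w‖ - ‖v‖)) • w := by
    rw [show ‖v‖⁻¹ * ‖w‖⁻¹ * (‖w‖ - ‖v‖) = ‖v‖⁻¹ - ‖w‖⁻¹ by field_simp]
    module
  have h1 : ‖v‖⁻¹ ≤ 1 := inv_le_one_of_one_le₀ hv
  rw [e]
  refine (norm_add_le _ _).trans ?_
  rw [norm_smul, norm_smul, norm_mul, norm_mul, norm_inv, norm_inv, norm_norm, norm_norm]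
  have h2 : ‖v‖⁻¹ * ‖w‖⁻¹ * ‖‖w‖ - ‖v‖‖ * ‖w‖ = ‖v‖⁻¹ * ‖‖w‖ - ‖v‖‖ := by field_simp
  have h3 : ‖‖w‖ - ‖v‖‖ ≤ ‖v - w‖ := by
    rw [norm_sub_rev v w]
    exact abs_norm_sub_norm_le w v
  rw [h2, two_mul]
  exact add_le_add (mul_le_of_le_one_left (norm_nonneg _) h1)
    ((mul_le_of_le_one_left (norm_nonneg _) h1).trans h3)

/-- Lebesgue measure of a cone over a subset of a face of the cube. -/
lemma volume_le_volume_cone_face {m : ℕ} (i : Fin (m + 1)) {c : ℝ} (hc : |c| = 1)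
    {E : Set (Fin m → ℝ)} (hE : MeasurableSet E) {W : Set (EuclideanSpace ℝ (Fin (m + 1)))}
    (hW : ∀ ρ ∈ Ioo (0 : ℝ) 1, ∀ y ∈ E,
      ρ • (WithLp.toLp 2 (i.insertNth c y) : EuclideanSpace ℝ (Fin (m + 1))) ∈ W) :
    volume E ≤ 2 ^ (m + 1) * volume W := by
  have hcc : c * c = 1 := by rw [← abs_mul_abs_self, hc, one_mul]
  have hc0 : c ≠ 0 := by rintro rfl; simp at hcc
  let P : Set (ℝ × (Fin m → ℝ)) := {p | c * p.1 ∈ Ioo (1 / 2 : ℝ) 1 ∧ (c * p.1)⁻¹ • p.2 ∈ E}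
  have hP : MeasurableSet P := by
    have h1 : Measurable fun p : ℝ × (Fin m → ℝ) => c * p.1 := measurable_fst.const_mul c
    exact (h1 measurableSet_Ioo).inter ((h1.inv.smul measurable_snd) hE)
  let Φ : EuclideanSpace ℝ (Fin (m + 1)) ≃ᵐ ℝ × (Fin m → ℝ) :=
    (MeasurableEquiv.toLp 2 (Fin (m + 1) → ℝ)).symm.trans
      (MeasurableEquiv.piFinSuccAbove (fun _ => ℝ) i)
  have hΦ : MeasurePreserving Φ volume volume :=
    (volume_preserving_piFinSuccAbove (fun _ => ℝ) i).comp
      (PiLp.volume_preserving_ofLp (Fin (m + 1)))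
  have hPW : Φ ⁻¹' P ⊆ W := by
    intro x hx
    have hx1 : c * x i ∈ Ioo (1 / 2 : ℝ) 1 := hx.1
    have hx2 : (c * x i)⁻¹ • (i.removeNth x.ofLp) ∈ E := hx.2
    have h0 : c * x i ≠ 0 := by linarith [hx1.1]
    have := hW (c * x i) ⟨by linarith [hx1.1], hx1.2⟩ _ hx2
    convert this using 1
    ext j
    rcases Fin.eq_self_or_eq_succAbove i j with rfl | ⟨k, rfl⟩
    · simp only [PiLp.smul_apply, Fin.insertNth_apply_same, smul_eq_mul]
      linear_combination (-x j) * hcc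
    · simp only [PiLp.smul_apply, Fin.insertNth_apply_succAbove, smul_eq_mul, Pi.smul_apply,
        Fin.removeNth]
      rw [mul_inv_cancel_left₀ h0]
  have hvP : volume (Φ ⁻¹' P) = ∫⁻ τ, volume (Prod.mk τ ⁻¹' P) := by
    rw [hΦ.measure_preimage_equiv, Measure.volume_eq_prod, Measure.prod_apply hP]
  have hslice : ∀ τ : ℝ, ((c * ·) ⁻¹' Ioo (1 / 2 : ℝ) 1).indicator
      (fun _ => ENNReal.ofReal ((1 / 2) ^ m) * volume E) τ ≤ volume (Prod.mk τ ⁻¹' P) := by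
    intro τ
    by_cases hτ : c * τ ∈ Ioo (1 / 2 : ℝ) 1
    · rw [indicator_of_mem (by exact hτ)]
      have h0 : 0 < c * τ := by linarith [hτ.1]
      have : Prod.mk τ ⁻¹' P = (fun z => (c * τ)⁻¹ • z) ⁻¹' E := by
        ext z
        exact and_iff_right hτ
      rw [this, Measure.addHaar_preimage_smul _ (inv_ne_zero h0.ne'), Module.finrank_fin_fun,
        inv_pow, inv_inv, abs_of_nonneg (by positivity)]
      exact mul_le_mul' (ENNReal.ofReal_le_ofReal
        (pow_le_pow_left₀ (by norm_num) hτ.1.le m)) le_rfl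
    · rw [indicator_of_notMem (by exact hτ)]
      exact zero_le
  have hmeas : MeasurableSet ((c * ·) ⁻¹' Ioo (1 / 2 : ℝ) 1) :=
    (measurable_id.const_mul c) measurableSet_Ioo
  have h1 := lintegral_mono (μ := volume) hslice
  rw [lintegral_indicator hmeas, setLIntegral_const, Real.volume_preimage_mul_left hc0, abs_inv, hc,
    inv_one, ENNReal.ofReal_one, one_mul, Real.volume_Ioo, ← hvP] at h1
  have h2 := h1.trans (measure_mono hPW)
  calc volume E = 2 ^ (m + 1) * (ENNReal.ofReal ((1 / 2) ^ m) * volume E *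
        ENNReal.ofReal (1 - 1 / 2)) := by
        rw [mul_right_comm, ← ENNReal.ofReal_mul (by positivity), ← mul_assoc]
        have : (2 : ℝ≥0∞) ^ (m + 1) = ENNReal.ofReal (2 ^ (m + 1)) := by
          rw [ENNReal.ofReal_pow (by norm_num)]
          norm_num
        rw [this, ← ENNReal.ofReal_mul (by positivity)]
        have : (2 : ℝ) ^ (m + 1) * ((1 / 2) ^ m * (1 - 1 / 2)) = 1 := by
          rw [pow_succ, one_div, inv_pow]
          field_simp
          norm_num
        rw [this, ENNReal.ofReal_one, one_mul]
    _ ≤ _ := mul_le_mul' le_rfl h2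

lemma norm_toLp_insertNth_sub_le {m : ℕ} (i : Fin (m + 1)) (c : ℝ) (y z : Fin m → ℝ) :
    ‖(WithLp.toLp 2 (i.insertNth c y) : EuclideanSpace ℝ (Fin (m + 1))) -
      WithLp.toLp 2 (i.insertNth c z)‖ ≤ ((m : ℝ) + 1) * ‖y - z‖ := by
  have h0 : (0 : ℝ) ≤ ((m : ℝ) + 1) * ‖y - z‖ := by positivity
  rw [EuclideanSpace.norm_eq]
  refine Real.sqrt_le_iff.2 ⟨h0, ?_⟩
  have : ∀ k ∈ (Finset.univ : Finset (Fin (m + 1))),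
      ‖((WithLp.toLp 2 (i.insertNth c y) : EuclideanSpace ℝ (Fin (m + 1))) -
        (WithLp.toLp 2 (i.insertNth c z) : EuclideanSpace ℝ (Fin (m + 1)))) k‖ ^ 2 ≤ ‖y - z‖ ^ 2 := by
    intro k _
    refine pow_le_pow_left₀ (norm_nonneg _) ?_ 2
    rcases Fin.eq_self_or_eq_succAbove i k with rfl | ⟨l, rfl⟩
    · simp
    · simpa using norm_le_pi_norm (y - z) l
  refine (Finset.sum_le_sum this).trans ?_
  rw [Finset.sum_const, Finset.card_univ, Fintype.card_fin, nsmul_eq_mul, mul_pow]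
  refine mul_le_mul_of_nonneg_right ?_ (sq_nonneg _)
  push_cast
  nlinarith [(Nat.cast_nonneg m : (0 : ℝ) ≤ m)]

lemma one_le_norm_toLp_insertNth {m : ℕ} (i : Fin (m + 1)) {c : ℝ} (hc : |c| = 1)
    (y : Fin m → ℝ) :
    1 ≤ ‖(WithLp.toLp 2 (i.insertNth c y) : EuclideanSpace ℝ (Fin (m + 1)))‖ := by
  have := PiLp.norm_apply_le (WithLp.toLp 2 (i.insertNth c y) : EuclideanSpace ℝ (Fin (m + 1))) i
  simpa [hc] using this

lemma norm_toLp_insertNth_le {m : ℕ} (i : Fin (m + 1)) {c : ℝ} (hc : |c| = 1)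
    {y : Fin m → ℝ} (hy : ‖y‖ ≤ 1) :
    ‖(WithLp.toLp 2 (i.insertNth c y) : EuclideanSpace ℝ (Fin (m + 1)))‖ ≤ (m : ℝ) + 2 := by
  have h1 := norm_toLp_insertNth_sub_le i c y 0
  have h2 : (WithLp.toLp 2 (i.insertNth c 0) : EuclideanSpace ℝ (Fin (m + 1))) =
      EuclideanSpace.single i c := by
    ext k
    rcases Fin.eq_self_or_eq_succAbove i k with rfl | ⟨l, rfl⟩
    · simp
    · simp
  rw [h2, sub_zero] at h1
  have h3 : ‖EuclideanSpace.single i c‖ = 1 := by simp [hc]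
  have h4 := norm_sub_norm_le (WithLp.toLp 2 (i.insertNth c y) : EuclideanSpace ℝ (Fin (m + 1)))
    (EuclideanSpace.single i c)
  nlinarith [(Nat.cast_nonneg m : (0 : ℝ) ≤ m)]

/-- Radial projection of a face of the cube to the unit sphere. -/
noncomputable def faceProj {m : ℕ} (i : Fin (m + 1)) {c : ℝ} (hc : |c| = 1) (y : Fin m → ℝ) :
    sphere (0 : EuclideanSpace ℝ (Fin (m + 1))) 1 :=
  ⟨‖(WithLp.toLp 2 (i.insertNth c y) : EuclideanSpace ℝ (Fin (m + 1)))‖⁻¹ •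
      WithLp.toLp 2 (i.insertNth c y), by
    have := one_le_norm_toLp_insertNth i hc y
    rw [mem_sphere_zero_iff_norm, norm_smul, norm_inv, norm_norm, inv_mul_cancel₀ (by linarith)]⟩

lemma lipschitzWith_faceProj {m : ℕ} (i : Fin (m + 1)) {c : ℝ} (hc : |c| = 1) :
    LipschitzWith (2 * ((m : ℝ≥0) + 1)) (faceProj i hc) := by
  refine LipschitzWith.of_dist_le_mul fun y z => ?_
  rw [Subtype.dist_eq, dist_eq_norm, dist_eq_norm]
  have h := one_le_norm_toLp_insertNth i hc z
  refine (norm_normalize_sub_le (one_le_norm_toLp_insertNth i hc y)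
    (norm_pos_iff.1 (by linarith))).trans ?_
  have := norm_toLp_insertNth_sub_le i c y z
  push_cast
  linarith

open scoped Pointwise in
lemma hausdorffMeasure_face_le {m : ℕ} (i : Fin (m + 1)) {c : ℝ} (hc : |c| = 1)
    {s : Set (sphere (0 : EuclideanSpace ℝ (Fin (m + 1))) 1)} (hs : MeasurableSet s) :
    μH[(m : ℝ)] (s ∩ {x | ∀ j, |x.1 j| ≤ c * x.1 i}) ≤
      (((2 * ((m : ℝ≥0) + 1) : ℝ≥0) : ℝ≥0∞) ^ (m : ℝ) * (2 ^ (m + 1) *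
        ENNReal.ofReal (((m : ℝ) + 2) ^ (m + 1)))) *
      (volume : Measure (EuclideanSpace ℝ (Fin (m + 1)))).toSphere s := by
  have hcc : c * c = 1 := by rw [← abs_mul_abs_self, hc, one_mul]
  have hc0 : c ≠ 0 := by rintro rfl; simp at hcc
  set E : Set (Fin m → ℝ) := faceProj i hc ⁻¹' s ∩ closedBall 0 1 with hEdef
  have hE : MeasurableSet E :=
    ((lipschitzWith_faceProj i hc).continuous.measurable hs).inter isClosed_closedBall.measurableSet
  have hsub : s ∩ {x | ∀ j, |x.1 j| ≤ c * x.1 i} ⊆ faceProj i hc '' E := by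
    rintro x ⟨hxs, hx⟩
    have hx : ∀ j, |x.1 j| ≤ c * x.1 i := hx
    have hn : ‖x.1‖ = 1 := by simp
    have hpos : 0 < c * x.1 i := by
      refine lt_of_le_of_ne ((abs_nonneg _).trans (hx i)) fun h0 => ?_
      have : x.1 = 0 := by
        ext j
        exact abs_nonpos_iff.1 (by rw [h0]; exact hx j)
      rw [this, norm_zero] at hn
      exact zero_ne_one hn
    set y : Fin m → ℝ := (c * x.1 i)⁻¹ • i.removeNth x.1.ofLp with hy
    have hv : (WithLp.toLp 2 (i.insertNth c y) : EuclideanSpace ℝ (Fin (m + 1))) =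
        (c * x.1 i)⁻¹ • x.1 := by
      ext j
      rcases Fin.eq_self_or_eq_succAbove i j with rfl | ⟨k, rfl⟩
      · simp only [PiLp.smul_apply, Fin.insertNth_apply_same, smul_eq_mul]
        have h0 : x.1 j ≠ 0 := right_ne_zero_of_mul hpos.ne'
        field_simp
        linear_combination hcc
      · simp [hy, Fin.removeNth]
    have hF : faceProj i hc y = x := by
      apply Subtype.ext
      change ‖(WithLp.toLp 2 (i.insertNth c y) : EuclideanSpace ℝ (Fin (m + 1)))‖⁻¹ •
        (WithLp.toLp 2 (i.insertNth c y) : EuclideanSpace ℝ (Fin (m + 1))) = x.1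
      rw [hv, norm_smul, hn, mul_one, Real.norm_of_nonneg (by positivity), inv_inv, smul_smul,
        mul_inv_cancel₀ hpos.ne', one_smul]
    refine ⟨y, ⟨by rw [mem_preimage, hF]; exact hxs, ?_⟩, hF⟩
    rw [mem_closedBall_zero_iff, pi_norm_le_iff_of_nonneg zero_le_one]
    intro k
    rw [hy, Pi.smul_apply, smul_eq_mul, norm_mul, norm_inv, Real.norm_of_nonneg hpos.le,
      inv_mul_le_iff₀ hpos, mul_one]
    exact hx _
  have hL : (0 : ℝ) < (m : ℝ) + 2 := by positivity
  have hvol := volume_le_volume_cone_face i hc hE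
    (W := ((m : ℝ) + 2) • (Ioo (0 : ℝ) 1 • (Subtype.val '' s))) (by
      intro ρ hρ y hy
      have h1 := one_le_norm_toLp_insertNth i hc y
      have h2 := norm_toLp_insertNth_le i hc (mem_closedBall_zero_iff.1 hy.2)
      set v : EuclideanSpace ℝ (Fin (m + 1)) := WithLp.toLp 2 (i.insertNth c y) with hv
      have hv0 : 0 < ‖v‖ := by linarith
      refine ⟨(ρ * ‖v‖ / ((m : ℝ) + 2)) • ((faceProj i hc y : _)).1, ?_, ?_⟩
      · refine Set.smul_mem_smul ⟨div_pos (mul_pos hρ.1 hv0) hL, ?_⟩ ⟨_, hy.1, rfl⟩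
        rw [div_lt_one hL]
        nlinarith [hρ.1, hρ.2]
      · change ((m : ℝ) + 2) • (ρ * ‖v‖ / ((m : ℝ) + 2)) • ‖v‖⁻¹ • v = ρ • v
        rw [smul_smul, smul_smul]
        congr 1
        field_simp)
  rw [Measure.addHaar_smul, finrank_euclideanSpace_fin, abs_of_nonneg (by positivity)] at hvol
  have hsph : volume (Ioo (0 : ℝ) 1 • (Subtype.val '' s)) ≤
      (volume : Measure (EuclideanSpace ℝ (Fin (m + 1)))).toSphere s := by
    rw [Measure.toSphere_apply' _ hs, finrank_euclideanSpace_fin]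
    exact le_mul_of_one_le_left zero_le (by exact_mod_cast Nat.succ_pos m)
  have hHE : μH[(m : ℝ)] E = volume E := by
    have := hausdorffMeasure_pi_real (ι := Fin m)
    rw [Fintype.card_fin] at this
    rw [this]
  calc μH[(m : ℝ)] (s ∩ {x | ∀ j, |x.1 j| ≤ c * x.1 i})
      ≤ μH[(m : ℝ)] (faceProj i hc '' E) := measure_mono hsub
    _ ≤ ((2 * ((m : ℝ≥0) + 1) : ℝ≥0) : ℝ≥0∞) ^ (m : ℝ) * μH[(m : ℝ)] E :=
        (lipschitzWith_faceProj i hc).hausdorffMeasure_image_le (Nat.cast_nonneg m) E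
    _ ≤ _ := by
        rw [hHE, mul_assoc, mul_assoc]
        refine mul_le_mul' le_rfl (hvol.trans (mul_le_mul' le_rfl (mul_le_mul' le_rfl hsph)))

theorem exists_hausdorffMeasure_le_smul_toSphere {n : ℕ} (hn : n ≠ 0) :
    ∃ C : ℝ≥0∞, C ≠ ∞ ∧ (μH[(n : ℝ) - 1] : Measure (sphere (0 : EuclideanSpace ℝ (Fin n)) 1)) ≤
      C • (volume : Measure (EuclideanSpace ℝ (Fin n))).toSphere := by
  obtain ⟨m, rfl⟩ := Nat.exists_eq_succ_of_ne_zero hn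
  have hm : ((m.succ : ℕ) : ℝ) - 1 = m := by push_cast; ring
  rw [hm]
  set D : ℝ≥0∞ := ((2 * ((m : ℝ≥0) + 1) : ℝ≥0) : ℝ≥0∞) ^ (m : ℝ) * (2 ^ (m + 1) *
        ENNReal.ofReal (((m : ℝ) + 2) ^ (m + 1))) with hD
  have hDt : D ≠ ∞ := by
    refine ENNReal.mul_ne_top (ENNReal.rpow_ne_top_of_nonneg (Nat.cast_nonneg m) ENNReal.coe_ne_top)
      (ENNReal.mul_ne_top (by simp) ENNReal.ofReal_ne_top)
  refine ⟨((m + 1 : ℕ) : ℝ≥0∞) * (D + D), ENNReal.mul_ne_top (by simp) (by simp [hDt]), ?_⟩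
  refine Measure.le_iff.2 fun s hs => ?_
  have hcov : s ⊆ ⋃ i : Fin (m + 1), ((s ∩ {x | ∀ j, |x.1 j| ≤ 1 * x.1 i}) ∪
      (s ∩ {x | ∀ j, |x.1 j| ≤ (-1) * x.1 i})) := by
    intro x hx
    obtain ⟨i, hi⟩ := Finite.exists_max fun j => |x.1 j|
    refine mem_iUnion.2 ⟨i, ?_⟩
    rcases le_total 0 (x.1 i) with h | h
    · left
      refine ⟨hx, fun j => ?_⟩
      rw [one_mul, ← abs_of_nonneg h]
      exact hi j
    · right
      refine ⟨hx, fun j => ?_⟩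
      rw [neg_one_mul, ← abs_of_nonpos h]
      exact hi j
  refine (measure_mono hcov).trans ((measure_iUnion_fintype_le _ _).trans ?_)
  rw [Measure.smul_apply, smul_eq_mul, mul_assoc]
  refine (Finset.sum_le_card_nsmul _ _ _ fun i _ => (measure_union_le _ _).trans
    (add_le_add (hausdorffMeasure_face_le i (by simp) hs)
      (hausdorffMeasure_face_le i (by simp) hs))).trans_eq ?_
  rw [Finset.card_univ, Fintype.card_fin, nsmul_eq_mul, add_mul]

open scoped Pointwise in
lemma hausdorffMeasure_restrict_sphere {n : ℕ} {d : ℝ} (hd : 0 ≤ d) {t : ℝ} (ht : 0 < t) :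
    (μH[d] : Measure (EuclideanSpace ℝ (Fin n))).restrict (sphere 0 t) =
      ENNReal.ofReal (t ^ d) • Measure.map
        (fun ω : sphere (0 : EuclideanSpace ℝ (Fin n)) 1 => t • (ω : EuclideanSpace ℝ (Fin n)))
        μH[d] := by
  ext s hs
  have hmeas : Measurable fun ω : sphere (0 : EuclideanSpace ℝ (Fin n)) 1 =>
      t • (ω : EuclideanSpace ℝ (Fin n)) := measurable_subtype_coe.const_smul t
  rw [Measure.restrict_apply hs, Measure.smul_apply, smul_eq_mul, Measure.map_apply hmeas hs]
  have h1 : s ∩ sphere 0 t = t • (Subtype.val '' ((fun ω : sphere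
      (0 : EuclideanSpace ℝ (Fin n)) 1 => t • (ω : EuclideanSpace ℝ (Fin n))) ⁻¹' s)) := by
    ext x
    constructor
    · rintro ⟨hxs, hx⟩
      rw [mem_sphere_zero_iff_norm] at hx
      have hx' : t • t⁻¹ • x = x := by rw [smul_smul, mul_inv_cancel₀ ht.ne', one_smul]
      refine ⟨t⁻¹ • x, ⟨⟨t⁻¹ • x, ?_⟩, ?_, rfl⟩, hx'⟩
      · rw [mem_sphere_zero_iff_norm, norm_smul, hx, norm_inv, Real.norm_of_nonneg ht.le,
          inv_mul_cancel₀ ht.ne']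
      · change t • t⁻¹ • x ∈ s
        rwa [hx']
    · rintro ⟨_, ⟨ω, hω, rfl⟩, rfl⟩
      refine ⟨hω, ?_⟩
      change t • ω.1 ∈ _
      rw [mem_sphere_zero_iff_norm, norm_smul, norm_eq_of_mem_sphere, Real.norm_of_nonneg ht.le,
        mul_one]
  rw [h1, Measure.hausdorffMeasure_smul₀ hd ht.ne',
    isometry_subtype_coe.hausdorffMeasure_image (Or.inl hd), ENNReal.smul_def, smul_eq_mul]
  congr 1
  rw [ENNReal.ofReal]
  congr 1
  ext
  rw [NNReal.coe_rpow, coe_nnnorm, Real.norm_of_nonneg ht.le, Real.coe_toNNReal _ (by positivity)]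

/-- Change of variables between the sphere of radius `t` and the unit sphere. -/
lemma setIntegral_sphere_hausdorffMeasure {n : ℕ} {d : ℝ} (hd : 0 ≤ d) {t : ℝ} (ht : 0 < t)
    (g : EuclideanSpace ℝ (Fin n) → ℝ) :
    ∫ x in sphere (0 : EuclideanSpace ℝ (Fin n)) t, g x ∂μH[d] =
      t ^ d * ∫ ω : sphere (0 : EuclideanSpace ℝ (Fin n)) 1, g (t • (ω : EuclideanSpace ℝ (Fin n)))
        ∂μH[d] := by
  have he : MeasurableEmbedding fun ω : sphere (0 : EuclideanSpace ℝ (Fin n)) 1 =>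
      t • (ω : EuclideanSpace ℝ (Fin n)) :=
    (Homeomorph.smulOfNeZero t ht.ne').measurableEmbedding.comp
      (MeasurableEmbedding.subtype_coe isClosed_sphere.measurableSet)
  rw [hausdorffMeasure_restrict_sphere hd ht, integral_smul_measure, he.integral_map,
    ENNReal.toReal_ofReal (by positivity), smul_eq_mul]

lemma toSphere_real_univ_le {n : ℕ} (hn : 2 ≤ n) :
    (volume : Measure (EuclideanSpace ℝ (Fin n))).toSphere.real univ ≤
      (μH[(n : ℝ) - 1] (sphere (0 : EuclideanSpace ℝ (Fin n)) 1)).toReal := by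
  obtain ⟨C, hC, hle⟩ := exists_hausdorffMeasure_le_smul_toSphere (n := n) (by omega)
  have h0 : (0 : ℝ) ≤ (n : ℝ) - 1 := by
    have : (2 : ℝ) ≤ n := by exact_mod_cast hn
    linarith
  have h1 : μH[(n : ℝ) - 1] (sphere (0 : EuclideanSpace ℝ (Fin n)) 1) =
      μH[(n : ℝ) - 1] (univ : Set (sphere (0 : EuclideanSpace ℝ (Fin n)) 1)) := by
    have hi : Isometry (Subtype.val : sphere (0 : EuclideanSpace ℝ (Fin n)) 1 → _) :=
      isometry_subtype_coe
    rw [← hi.hausdorffMeasure_image (Or.inl h0), image_univ, Subtype.range_coe]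
  rw [h1]
  refine ENNReal.toReal_mono ?_ (toSphere_le_hausdorffMeasure hn univ)
  refine ((hle univ).trans_lt ?_).ne
  rw [Measure.smul_apply, smul_eq_mul]
  exact ENNReal.mul_lt_top hC.lt_top (measure_lt_top _ _)

lemma integral_toSphere_le_integral_hausdorffMeasure {n : ℕ} (hn : 2 ≤ n)
    {g : sphere (0 : EuclideanSpace ℝ (Fin n)) 1 → ℝ} (hg0 : ∀ ω, 0 ≤ g ω)
    (hg : Integrable g (volume : Measure (EuclideanSpace ℝ (Fin n))).toSphere) :
    ∫ ω, g ω ∂(volume : Measure (EuclideanSpace ℝ (Fin n))).toSphere ≤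
      ∫ ω, g ω ∂μH[(n : ℝ) - 1] := by
  obtain ⟨C, hC, hle⟩ := exists_hausdorffMeasure_le_smul_toSphere (n := n) (by omega)
  exact integral_mono_measure (toSphere_le_hausdorffMeasure hn) (Filter.Eventually.of_forall hg0)
    (hg.of_measure_le_smul hC hle)

/-- The isoperimetric estimate on balls on which the density is integrable. -/
theorem integral_logDensity_le_hausdorffMeasure {n : ℕ} (hn : 2 ≤ n) {q R K : ℝ} (hqR : q ≤ R)
    (hK : 0 ≤ K) {f : EuclideanSpace ℝ (Fin n) → EuclideanSpace ℝ (Fin n)}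
    (hf : ∀ x ∈ ball (0 : EuclideanSpace ℝ (Fin n)) R, ContDiffAt ℝ 2 f x)
    (hf1 : ∀ x ∈ ball (0 : EuclideanSpace ℝ (Fin n)) R, ‖f x‖ ^ 2 < 1)
    (hJ : ∀ x ∈ ball (0 : EuclideanSpace ℝ (Fin n)) R, 0 ≤ (jacobianMatrix f x).det)
    (hcof : ∀ᵐ x ∂(volume.restrict (ball (0 : EuclideanSpace ℝ (Fin n)) R)),
      matOpNorm (cofMatrix (jacobianMatrix f x)) ^ n ≤ K * (jacobianMatrix f x).det ^ (n - 1))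
    (hg : IntegrableOn (logDensity f) (ball 0 q)) :
    ∀ᵐ t ∂(volume.restrict (Ioo 0 q)),
      2 * ((n : ℝ) - 1) * ∫ x in ball 0 t, logDensity f x ≤
        K ^ ((1 : ℝ) / n) *
          (μH[(n : ℝ) - 1] (sphere (0 : EuclideanSpace ℝ (Fin n)) 1)).toReal ^ ((1 : ℝ) / n) *
          t ^ (((n : ℝ) - 1) / n) *
          (∫ x in sphere 0 t, logDensity f x ∂μH[(n : ℝ) - 1]) ^ (((n : ℝ) - 1) / n) := by
  have hn1 : (0 : ℝ) ≤ (n : ℝ) - 1 := by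
    have : (2 : ℝ) ≤ n := by exact_mod_cast hn
    linarith
  filter_upwards [integral_logDensity_le_toSphere hn hqR hK hf hf1 hJ hcof hg,
    ae_restrict_mem measurableSet_Ioo] with t ⟨hInt, hle⟩ ht
  have ht0 : 0 < t := ht.1
  have hpos : ∀ ω : sphere (0 : EuclideanSpace ℝ (Fin n)) 1,
      0 ≤ logDensity f (t • (ω : EuclideanSpace ℝ (Fin n))) := by
    intro ω
    have hm : t • (ω : EuclideanSpace ℝ (Fin n)) ∈ ball (0 : EuclideanSpace ℝ (Fin n)) R := by
      rw [mem_ball_zero_iff, norm_smul, norm_eq_of_mem_sphere, Real.norm_of_nonneg ht0.le, mul_one]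
      exact ht.2.trans_le hqR
    exact logDensity_nonneg (hf1 _ hm) (hJ _ hm)
  have hI := integral_toSphere_le_integral_hausdorffMeasure hn hpos hInt
  have hI0 : 0 ≤ ∫ ω : sphere (0 : EuclideanSpace ℝ (Fin n)) 1,
      logDensity f (t • (ω : EuclideanSpace ℝ (Fin n))) ∂volume.toSphere :=
    integral_nonneg hpos
  have hpow : t ^ (n - 1) = t ^ ((n : ℝ) - 1) := by
    rw [← Real.rpow_natCast, Nat.cast_sub (by omega), Nat.cast_one]
  refine hle.trans ?_
  rw [setIntegral_sphere_hausdorffMeasure hn1 ht0, mul_assoc, mul_assoc]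
  refine mul_le_mul_of_nonneg_left ?_ (by positivity)
  rw [Real.mul_rpow (by positivity) (by positivity) (z := (1 : ℝ) / n), hpow,
    ← Real.rpow_mul ht0.le, mul_one_div]
  rw [mul_comm ((_ : ℝ) ^ ((1 : ℝ) / n)) (t ^ _ * _)]
  rw [mul_comm (_ ^ (((n : ℝ) - 1) / n)) (t ^ (((n : ℝ) - 1) / n) * _), mul_assoc, mul_assoc]
  refine mul_le_mul_of_nonneg_left ?_ (by positivity)
  rw [mul_comm]
  have hr : (0 : ℝ) ≤ ((n : ℝ) - 1) / n := by positivity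
  refine mul_le_mul (Real.rpow_le_rpow ?_ ?_ hr) (Real.rpow_le_rpow measureReal_nonneg
    (toSphere_real_univ_le hn) (by positivity)) (by positivity) ?_
  · positivity
  · exact mul_le_mul_of_nonneg_left hI (by positivity)
  · exact Real.rpow_nonneg (mul_nonneg (by positivity) (hI0.trans hI)) _

/-- The estimate on almost every sphere: radii of balls on which the density is not integrable
satisfy it trivially, the others are exhausted by balls of rational radius. -/
theorem ae_integral_logDensity_le {n : ℕ} (hn : 2 ≤ n) {R K : ℝ} (hK : 0 ≤ K)
    {f : EuclideanSpace ℝ (Fin n) → EuclideanSpace ℝ (Fin n)}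
    (hf : ∀ x ∈ ball (0 : EuclideanSpace ℝ (Fin n)) R, ContDiffAt ℝ 2 f x)
    (hf1 : ∀ x ∈ ball (0 : EuclideanSpace ℝ (Fin n)) R, ‖f x‖ ^ 2 < 1)
    (hJ : ∀ x ∈ ball (0 : EuclideanSpace ℝ (Fin n)) R, 0 ≤ (jacobianMatrix f x).det)
    (hcof : ∀ᵐ x ∂(volume.restrict (ball (0 : EuclideanSpace ℝ (Fin n)) R)),
      matOpNorm (cofMatrix (jacobianMatrix f x)) ^ n ≤ K * (jacobianMatrix f x).det ^ (n - 1)) :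
    ∀ᵐ t ∂(volume.restrict (Ioo 0 R)),
      2 * ((n : ℝ) - 1) * ∫ x in ball 0 t, logDensity f x ≤
        K ^ ((1 : ℝ) / n) *
          (μH[(n : ℝ) - 1] (sphere (0 : EuclideanSpace ℝ (Fin n)) 1)).toReal ^ ((1 : ℝ) / n) *
          t ^ (((n : ℝ) - 1) / n) *
          (∫ x in sphere 0 t, logDensity f x ∂μH[(n : ℝ) - 1]) ^ (((n : ℝ) - 1) / n) := by
  set T : Set ℝ := {t | t < R ∧ IntegrableOn (logDensity f) (ball 0 t)} with hT
  have hTb : BddAbove T := ⟨R, fun t ht => ht.1.le⟩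
  have hq : ∀ᵐ t : ℝ, ∀ q : ℚ, (q : ℝ) ∈ T → t ∈ Ioo (0 : ℝ) q →
      2 * ((n : ℝ) - 1) * ∫ x in ball 0 t, logDensity f x ≤
        K ^ ((1 : ℝ) / n) *
          (μH[(n : ℝ) - 1] (sphere (0 : EuclideanSpace ℝ (Fin n)) 1)).toReal ^ ((1 : ℝ) / n) *
          t ^ (((n : ℝ) - 1) / n) *
          (∫ x in sphere 0 t, logDensity f x ∂μH[(n : ℝ) - 1]) ^ (((n : ℝ) - 1) / n) := by
    refine ae_all_iff.2 fun q => ?_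
    by_cases hqT : (q : ℝ) ∈ T
    · filter_upwards [(ae_restrict_iff' measurableSet_Ioo).1
        (integral_logDensity_le_hausdorffMeasure hn hqT.1.le hK hf hf1 hJ hcof hqT.2)] with t ht _
      exact ht
    · exact Filter.Eventually.of_forall fun t h => absurd h hqT
  have hne : ∀ᵐ t : ℝ, t ≠ sSup T := by
    rw [ae_iff]
    simp
  rw [ae_restrict_iff' measurableSet_Ioo]
  filter_upwards [hq, hne] with t hqt htne ht
  have ht0 : 0 < t := ht.1
  by_cases htT : t ∈ T
  · have hlt : t < sSup T := lt_of_le_of_ne (le_csSup hTb htT) htne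
    obtain ⟨u, hu, htu⟩ := exists_lt_of_lt_csSup ⟨t, htT⟩ hlt
    obtain ⟨q, htq, hqu⟩ := exists_rat_btwn htu
    exact hqt q ⟨hqu.trans hu.1, hu.2.mono_set (ball_subset_ball hqu.le)⟩ ⟨ht0, htq⟩
  · rw [integral_undef fun h => htT ⟨ht.2, h⟩, mul_zero]
    have : 0 ≤ ∫ x in sphere 0 t, logDensity f x ∂μH[(n : ℝ) - 1] := by
      refine setIntegral_nonneg isClosed_sphere.measurableSet fun x hx => ?_
      have hm : x ∈ ball (0 : EuclideanSpace ℝ (Fin n)) R := by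
        rw [mem_ball_zero_iff, mem_sphere_zero_iff_norm.1 hx]
        exact ht.2
      exact logDensity_nonneg (hf1 _ hm) (hJ _ hm)
    positivity

/-- Under the hypotheses of Statement 10 together with the
inner dilatation bound `‖cof Df‖ⁿ ≤ K_I J_f^{n-1}` a.e., for almost every
`t ∈ (0,R)`:
`2(n-1) ∫_{B(0,t)} J_f/(|f|ⁿ logⁿ(1/|f|²))
  ≤ K_I^{1/n} ω_{n-1}^{1/n} t^{(n-1)/n}
    (∫_{∂B(0,t)} J_f/(|f|ⁿ logⁿ(1/|f|²)) dH^{n-1})^{(n-1)/n}`,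
where `ω_{n-1} = H^{n-1}(S^{n-1})` and the integrals are over the sets where `f ≠ 0`. -/
theorem stmt11 (n : ℕ) (hn : 2 ≤ n)
    (U : Set (EuclideanSpace ℝ (Fin n))) (hUopen : IsOpen U)
    (R : ℝ) (hR : 0 < R)
    (hRU : closedBall (0 : EuclideanSpace ℝ (Fin n)) R ⊆ U)
    (f : EuclideanSpace ℝ (Fin n) → EuclideanSpace ℝ (Fin n))
    (hf : ContDiffOn ℝ (⊤ : ℕ∞) f U)
    -- J_f(x) ≥ 0 everywhere
    (hJ : ∀ x ∈ U, 0 ≤ (jacobianMatrix f x).det)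
    -- the zero set {f = 0} has Lebesgue measure zero
    (hZ : volume {x : EuclideanSpace ℝ (Fin n) | f x = 0} = 0)
    -- 0 < |f(x)| < 1 off the zero set on B̄(0,R)
    (hf01 : ∀ x ∈ closedBall (0 : EuclideanSpace ℝ (Fin n)) R,
      f x ≠ 0 → 0 < ‖f x‖ ∧ ‖f x‖ < 1)
    (K_I : ℝ) (hK : 1 ≤ K_I)
    -- ‖cof Df(x)‖ⁿ ≤ K_I J_f(x)^{n-1} almost everywhere
    (hcof : ∀ᵐ x ∂(volume.restrict U),
      matOpNorm (cofMatrix (jacobianMatrix f x)) ^ n ≤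
        K_I * (jacobianMatrix f x).det ^ (n - 1)) :
    ∀ᵐ t ∂(volume.restrict (Set.Ioo 0 R)),
      2 * ((n : ℝ) - 1) *
        ∫ x in ball (0 : EuclideanSpace ℝ (Fin n)) t ∩ {x | f x ≠ 0},
          (jacobianMatrix f x).det / (‖f x‖ ^ n * Real.log (1 / ‖f x‖ ^ 2) ^ n) ≤
      K_I ^ ((1 : ℝ) / n) *
        (μH[(n : ℝ) - 1] (sphere (0 : EuclideanSpace ℝ (Fin n)) 1)).toReal ^ ((1 : ℝ) / n) *
        t ^ (((n : ℝ) - 1) / n) *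
        (∫ x in sphere (0 : EuclideanSpace ℝ (Fin n)) t ∩ {x | f x ≠ 0},
            (jacobianMatrix f x).det / (‖f x‖ ^ n * Real.log (1 / ‖f x‖ ^ 2) ^ n)
            ∂(μH[(n : ℝ) - 1])) ^ (((n : ℝ) - 1) / n) := by
  have hRU' : ball (0 : EuclideanSpace ℝ (Fin n)) R ⊆ U := ball_subset_closedBall.trans hRU
  have hf2 : ∀ x ∈ ball (0 : EuclideanSpace ℝ (Fin n)) R, ContDiffAt ℝ 2 f x := fun x hx =>
    (hf.contDiffAt (hUopen.mem_nhds (hRU' hx))).of_le (WithTop.coe_le_coe.2 (le_top : (2 : ℕ∞) ≤ ⊤))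
  have hf1 : ∀ x ∈ ball (0 : EuclideanSpace ℝ (Fin n)) R, ‖f x‖ ^ 2 < 1 := by
    intro x hx
    by_cases h0 : f x = 0
    · simp [h0]
    · have := hf01 x (ball_subset_closedBall hx) h0
      nlinarith
  have hzero : ∀ A : Set (EuclideanSpace ℝ (Fin n)),
      ∀ x ∈ A \ (A ∩ {x | f x ≠ 0}), logDensity f x = 0 := by
    intro A x hx
    have h0 : f x = 0 := by
      by_contra h
      exact hx.2 ⟨hx.1, h⟩
    exact logDensity_eq_zero (by omega) h0
  filter_upwards [ae_integral_logDensity_le hn (zero_le_one.trans hK) hf2 hf1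
    (fun x hx => hJ x (hRU' hx)) (ae_restrict_of_ae_restrict_of_subset hRU' hcof)] with t ht
  rw [setIntegral_eq_of_subset_of_forall_sdiff_eq_zero isOpen_ball.measurableSet inter_subset_left
    (hzero _), setIntegral_eq_of_subset_of_forall_sdiff_eq_zero isClosed_sphere.measurableSet
    inter_subset_left (hzero _)] at ht
  exact ht
end

section
/- Let n ≥ 2, let 0 < R and let φ : (0, R) → (0, ∞) be a nondecreasing, locally absolutely continuous, strictly positive function such that φ(t) ≤ C · t^{(n-1)/n} · (φ'(t))^{(n-1)/n} for almost every t ∈ (0, R), where C > 0 is a constant. Then for every 0 < r < R one has φ(r) ≤ Cⁿ · (n−1)^{n-1} / (log(R/r))^{n-1}. -/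
open MeasureTheory Set

/-- If `φ` is positive and monotone on `[a, b]` and satisfies `φ ^ (p + 1) ≤ K t φ'` almost
everywhere there, then `φ ^ (-p)` drops by at least `(p / K) log (b / a)` between `a` and `b`. -/
lemma mul_log_div_le_rpow_neg_sub_of_rpow_le_mul_deriv {φ : ℝ → ℝ} {a b p K : ℝ} (ha : 0 < a)
    (hab : a ≤ b) (hp : 0 < p) (hK : 0 < K) (hpos : ∀ t ∈ Icc a b, 0 < φ t)
    (hmono : MonotoneOn φ (Icc a b))
    (hineq : ∀ᵐ t ∂(volume.restrict (Icc a b)), φ t ^ (p + 1) ≤ K * (t * deriv φ t)) :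
    p / K * Real.log (b / a) ≤ φ a ^ (-p) - φ b ^ (-p) := by
  have hG : MonotoneOn (fun t => -φ t ^ (-p)) (uIcc a b) := by
    rw [uIcc_of_le hab]
    intro x hx y hy hxy
    exact neg_le_neg (Real.rpow_le_rpow_of_nonpos (hpos x hx) (hmono hx hy hxy) (by linarith))
  have hint := hG.intervalIntegral_deriv_mem_uIcc
  have hGab := hG left_mem_uIcc right_mem_uIcc hab
  rw [uIcc_of_le (sub_nonneg.2 hGab)] at hint
  have hle : ∫ t in a..b, p / K * (1 / t) ≤ ∫ t in a..b, deriv (fun t => -φ t ^ (-p)) t := by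
    refine intervalIntegral.integral_mono_ae_restrict hab ?_ hG.intervalIntegrable_deriv ?_
    · refine (intervalIntegral.intervalIntegrable_one_div ?_ continuousOn_id).const_mul _
      intro x hx
      rw [uIcc_of_le hab] at hx
      exact (ha.trans_le hx.1).ne'
    · filter_upwards [hineq, ae_restrict_mem measurableSet_Icc] with t ht htab
      have ht0 : 0 < t := ha.trans_le htab.1
      have hφ := hpos t htab
      have hφp : 0 < φ t ^ (p + 1) := Real.rpow_pos_of_pos hφ _
      have hd : deriv φ t ≠ 0 := by
        intro h
        rw [h, mul_zero, mul_zero] at ht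
        linarith
      have hderiv := ((differentiableAt_of_deriv_ne_zero hd).hasDerivAt.rpow_const
        (p := -p) (Or.inl hφ.ne')).neg
      have hval : deriv (fun t => -φ t ^ (-p)) t = p * (deriv φ t / φ t ^ (p + 1)) := by
        refine hderiv.deriv.trans ?_
        rw [show -p - 1 = -(p + 1) by ring, Real.rpow_neg hφ.le]
        ring
      rw [hval, div_mul_div_comm, mul_one, mul_div_assoc', div_le_div_iff₀ (by positivity) hφp]
      nlinarith
  rw [intervalIntegral.integral_const_mul, integral_one_div_of_pos ha (ha.trans_le hab)] at hle
  linarith [hint.2]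

/-- (ODE lemma.) Let `n ≥ 2`, `R > 0`, and let
`φ : (0,R) → (0,∞)` be nondecreasing, locally absolutely continuous (encoded by
the fundamental theorem of calculus for `φ` on compact subintervals of `(0,R)`)
and satisfy `φ(t) ≤ C t^{(n-1)/n} (φ'(t))^{(n-1)/n}` for a.e. `t ∈ (0,R)`.
Then `φ(r) ≤ Cⁿ (n-1)^{n-1} / log^{n-1}(R/r)` for every `0 < r < R`. -/
theorem stmt12 (n : ℕ) (hn : 2 ≤ n) (R : ℝ) (hR : 0 < R)
    (C : ℝ) (hC : 0 < C) (φ : ℝ → ℝ)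
    -- φ is strictly positive on (0,R)
    (hpos : ∀ t ∈ Set.Ioo (0 : ℝ) R, 0 < φ t)
    -- φ is nondecreasing on (0,R)
    (hmono : MonotoneOn φ (Set.Ioo (0 : ℝ) R))
    -- φ is locally absolutely continuous on (0,R): on every compact
    -- subinterval its derivative is integrable and FTC holds
    (hac : ∀ a b : ℝ, 0 < a → b < R → a ≤ b →
      IntervalIntegrable (deriv φ) volume a b ∧
      φ b - φ a = ∫ t in a..b, deriv φ t)
    -- the differential inequality, almost everywhere on (0,R)
    (hineq : ∀ᵐ t ∂(volume.restrict (Set.Ioo (0 : ℝ) R)),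
      φ t ≤ C * t ^ (((n : ℝ) - 1) / n) * deriv φ t ^ (((n : ℝ) - 1) / n)) :
    ∀ r : ℝ, 0 < r → r < R →
      φ r ≤ C ^ n * ((n : ℝ) - 1) ^ (n - 1) / Real.log (R / r) ^ (n - 1) := by
  intro r hr hrR
  obtain ⟨k, rfl⟩ : ∃ k, n = k + 1 := ⟨n - 1, by omega⟩
  have hk : (0 : ℝ) < k := by exact_mod_cast (by omega : 0 < k)
  simp only [Nat.cast_add, Nat.cast_one, add_sub_cancel_right, Nat.add_sub_cancel] at hineq ⊢
  set p : ℝ := (k : ℝ)⁻¹ with hp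
  have hp0 : 0 < p := inv_pos.2 hk
  have hexp : (k : ℝ) / (k + 1) * (p + 1) = 1 := by rw [hp]; field_simp; ring
  have hφr : 0 < φ r := hpos r ⟨hr, hrR⟩
  have hpow : ∀ᵐ t ∂(volume.restrict (Ioo (0 : ℝ) R)),
      φ t ^ (p + 1) ≤ C ^ (p + 1) * (t * deriv φ t) := by
    filter_upwards [hineq, ae_restrict_mem measurableSet_Ioo] with t ht htR
    have hd : 0 ≤ deriv φ t := by
      rw [← derivWithin_of_isOpen isOpen_Ioo htR]
      exact hmono.derivWithin_nonneg
    have hdp := Real.rpow_nonneg hd ((k : ℝ) / (k + 1))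
    have htp := Real.rpow_nonneg htR.1.le ((k : ℝ) / (k + 1))
    refine (Real.rpow_le_rpow (hpos t htR).le ht (by positivity)).trans_eq ?_
    rw [Real.mul_rpow (by positivity) hdp, Real.mul_rpow hC.le htp, ← Real.rpow_mul htR.1.le,
      ← Real.rpow_mul hd, hexp, Real.rpow_one, Real.rpow_one, mul_assoc]
  have hlog : ∀ b ∈ Ioo r R, p / C ^ (p + 1) * Real.log (b / r) ≤ φ r ^ (-p) := by
    intro b hb
    have hsub : Icc r b ⊆ Ioo 0 R := fun x hx => ⟨hr.trans_le hx.1, hx.2.trans_lt hb.2⟩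
    have := mul_log_div_le_rpow_neg_sub_of_rpow_le_mul_deriv hr hb.1.le hp0
      (Real.rpow_pos_of_pos hC (p + 1)) (fun t ht => hpos t (hsub ht)) (hmono.mono hsub)
      (ae_restrict_of_ae_restrict_of_subset hsub hpow)
    linarith [Real.rpow_nonneg (hpos b (hsub (right_mem_Icc.2 hb.1.le))).le (-p)]
  have hlim : p / C ^ (p + 1) * Real.log (R / r) ≤ φ r ^ (-p) := by
    have hcont : ContinuousAt (fun b => p / C ^ (p + 1) * Real.log (b / r)) R :=
      continuousAt_const.mul ((continuousAt_id.div_const r).log (div_pos hR hr).ne')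
    refine le_of_tendsto (hcont.tendsto.mono_left (nhdsWithin_le_nhds (s := Iio R))) ?_
    filter_upwards [Ioo_mem_nhdsLT hrR] with b hb using hlog b hb
  have hL : 0 < Real.log (R / r) := Real.log_pos ((one_lt_div hr).2 hrR)
  have hCp : 0 < C ^ (p + 1) := Real.rpow_pos_of_pos hC _
  have hφp : 0 < φ r ^ p := Real.rpow_pos_of_pos hφr _
  have hroot : φ r ^ p ≤ C ^ (p + 1) * k / Real.log (R / r) := by
    rw [Real.rpow_neg hφr.le, le_inv_comm₀ (by positivity) hφp] at hlim
    refine hlim.trans_eq ?_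
    rw [hp]
    field_simp
  have := pow_le_pow_left₀ hφp.le hroot k
  rw [div_pow, mul_pow, ← Real.rpow_mul_natCast hφr.le, ← Real.rpow_mul_natCast hC.le,
    show p * k = 1 from inv_mul_cancel₀ hk.ne', Real.rpow_one,
    show (p + 1) * k = ((k + 1 : ℕ) : ℝ) by rw [hp]; push_cast; field_simp; ring,
    Real.rpow_natCast] at this
  exact this
end

section
/- Let n ≥ 2, let U ⊆ ℝⁿ be open, and let f : U → ℝⁿ be a continuous, discrete, and open mapping. Then for every x ∈ U there exists a radius r_x > 0 such that for every 0 < r ≤ r_x, the connected component U(x, f, r) of f⁻¹(B(f(x), r)) containing x satisfies: (i) U(x,f,r) is a normal neighborhood of x, i.e. its closure is compact and contained in U, f(∂U(x,f,r)) = ∂f(U(x,f,r)), and U(x,f,r) ∩ f⁻¹(f(x)) = {x}; (ii) f(U(x, f, r)) = B(f(x), r); and (iii) diam(U(x, f, r)) → 0 as r → 0. -/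
open Metric Set Filter Topology

/-- A preconnected set through the center of a ball which misses the sphere lies in the ball. -/
theorem IsPreconnected.subset_ball_of_disjoint_sphere {X : Type*} [PseudoMetricSpace X]
    {C : Set X} {x : X} {ε : ℝ} (hC : IsPreconnected C) (hx : x ∈ C) (hε : 0 < ε)
    (h : ∀ z ∈ C, dist z x ≠ ε) : C ⊆ ball x ε := by
  refine hC.subset_left_of_subset_union isOpen_ball
    (v := (closedBall x ε)ᶜ) isClosed_closedBall.isOpen_compl ?_ ?_
    ⟨x, hx, mem_ball_self hε⟩
  · exact disjoint_left.2 fun z hz hz' => hz' (ball_subset_closedBall hz)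
  · intro z hz
    rcases lt_or_gt_of_ne (h z hz) with hlt | hgt
    · exact Or.inl hlt
    · exact Or.inr fun hz' => (not_le_of_gt hgt) hz'

/-- If `x` is the only point of its fiber in a compact ball, then the `x`-components of preimages of
small balls around `f x` lie in that ball. -/
theorem exists_connectedComponentIn_preimage_ball_subset_ball {X Y : Type*} [MetricSpace X]
    [ProperSpace X] [MetricSpace Y] {U : Set X} {f : X → Y} (hcont : ContinuousOn f U) {x : X}
    (hx : x ∈ U) {ε : ℝ} (hε : 0 < ε) (hU : closedBall x ε ⊆ U)
    (hfib : ∀ z ∈ closedBall x ε, f z = f x → z = x) :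
    ∃ δ > 0, ∀ r : ℝ, 0 < r → r ≤ δ →
      connectedComponentIn (U ∩ f ⁻¹' ball (f x) r) x ⊆ ball x ε := by
  have hdist : ContinuousOn (fun z => dist (f z) (f x)) (sphere x ε) :=
    continuous_dist.comp_continuousOn
      ((hcont.mono (sphere_subset_closedBall.trans hU)).prodMk continuousOn_const)
  obtain ⟨δ, hδ, hδs⟩ : ∃ δ > 0, ∀ z ∈ sphere x ε, δ ≤ dist (f z) (f x) := by
    refine (isCompact_sphere x ε).exists_forall_le' hdist fun z hz => dist_pos.2 fun hfz => ?_
    have hzx := hfib z (sphere_subset_closedBall hz) hfz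
    rw [hzx, mem_sphere, dist_self] at hz
    exact hε.ne hz
  refine ⟨δ, hδ, fun r hr hrδ => ?_⟩
  refine isPreconnected_connectedComponentIn.subset_ball_of_disjoint_sphere
    (mem_connectedComponentIn ⟨hx, mem_ball_self hr⟩) hε fun z hz hzε => ?_
  have hzr : dist (f z) (f x) < r := (connectedComponentIn_subset _ _ hz).2
  linarith [hδs z hzε]

/-- The closure of a component of a set `F` meets `F` only in that component. -/
theorem closure_connectedComponentIn_inter_subset {X : Type*} [TopologicalSpace X] {F : Set X}
    {x : X} (hx : x ∈ F) :
    closure (connectedComponentIn F x) ∩ F ⊆ connectedComponentIn F x := by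
  have hpre : IsPreconnected (closure (connectedComponentIn F x) ∩ F) :=
    isPreconnected_connectedComponentIn.subset_closure
      (subset_inter subset_closure (connectedComponentIn_subset _ _)) inter_subset_left
  exact hpre.subset_connectedComponentIn
    ⟨subset_closure (mem_connectedComponentIn hx), hx⟩ inter_subset_right

/-- If the `x`-component of the preimage of a ball under a continuous open map is relatively compact
in the domain, it is mapped onto the ball, and its frontier onto the sphere. -/
theorem image_connectedComponentIn_preimage_ball {X E : Type*} [TopologicalSpace X]
    [LocallyConnectedSpace X] [NormedAddCommGroup E] [NormedSpace ℝ E] {U : Set X}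
    (hUopen : IsOpen U) {f : X → E} (hcont : ContinuousOn f U)
    (hopen : ∀ V ⊆ U, IsOpen V → IsOpen (f '' V)) {x : X} (hx : x ∈ U) {r : ℝ} (hr : 0 < r)
    (hcpt : IsCompact (closure (connectedComponentIn (U ∩ f ⁻¹' ball (f x) r) x)))
    (hcl : closure (connectedComponentIn (U ∩ f ⁻¹' ball (f x) r) x) ⊆ U) :
    f '' connectedComponentIn (U ∩ f ⁻¹' ball (f x) r) x = ball (f x) r ∧
      f '' frontier (connectedComponentIn (U ∩ f ⁻¹' ball (f x) r) x) = sphere (f x) r := by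
  set V := U ∩ f ⁻¹' ball (f x) r with hV
  set C := connectedComponentIn V x with hC
  have hxV : x ∈ V := ⟨hx, mem_ball_self hr⟩
  have hxC : x ∈ C := mem_connectedComponentIn hxV
  have hCV : C ⊆ V := connectedComponentIn_subset _ _
  have hCopen : IsOpen C := (hcont.isOpen_inter_preimage hUopen isOpen_ball).connectedComponentIn
  have hfCball : f '' C ⊆ ball (f x) r := image_subset_iff.2 fun z hz => (hCV hz).2
  have hclV : closure C ∩ V ⊆ C := closure_connectedComponentIn_inter_subset hxV
  have hK : IsClosed (f '' closure C) := (hcpt.image_of_continuousOn (hcont.mono hcl)).isClosed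
  have hKball : f '' closure C ∩ ball (f x) r ⊆ f '' C := by
    rintro _ ⟨⟨z, hz, rfl⟩, hzr⟩
    exact mem_image_of_mem f (hclV ⟨hz, hcl hz, hzr⟩)
  have himg : f '' C = ball (f x) r := by
    refine hfCball.antisymm ?_
    refine (convex_ball (f x) r).isPreconnected.subset_of_closure_inter_subset
      (hopen C (hCV.trans inter_subset_left) hCopen)
      ⟨f x, mem_ball_self hr, mem_image_of_mem f hxC⟩ ?_
    exact (inter_subset_inter_left _
      (closure_minimal (image_mono subset_closure) hK)).trans hKball
  refine ⟨himg, ?_⟩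
  rw [hCopen.frontier_eq]
  refine Subset.antisymm ?_ fun y hy => ?_
  · rintro _ ⟨z, ⟨hz, hzC⟩, rfl⟩
    have hle : f z ∈ closedBall (f x) r := by
      rw [← closure_ball _ hr.ne']
      exact closure_mono hfCball
        (((hcont.mono hcl).image_closure) (mem_image_of_mem f hz))
    refine le_antisymm hle (not_lt.1 fun hlt => hzC (hclV ⟨hz, hcl hz, hlt⟩))
  · have hycl : y ∈ f '' closure C := by
      refine closure_minimal (image_mono subset_closure) hK ?_
      rw [himg, closure_ball _ hr.ne']
      exact sphere_subset_closedBall hy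
    obtain ⟨z, hz, rfl⟩ := hycl
    exact mem_image_of_mem f ⟨hz, fun hzC => (hfCball (mem_image_of_mem f hzC)).ne hy⟩

/-- (Rickman's normal neighborhood lemma.) Let `f : U → ℝⁿ`
(`U ⊆ ℝⁿ` open, `n ≥ 2`) be continuous, discrete and open. For every `x ∈ U`
there is `r_x > 0` such that for all `0 < r ≤ r_x` the `x`-component
`U(x,f,r)` of `f⁻¹(B(f(x),r))` is a normal neighborhood of `x` (compact closure
contained in `U`, `f(∂U(x,f,r)) = ∂f(U(x,f,r))`, and
`U(x,f,r) ∩ f⁻¹(f(x)) = {x}`) with `f(U(x,f,r)) = B(f(x),r)`; moreover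
`diam U(x,f,r) → 0` as `r → 0`. -/
theorem stmt15 (n : ℕ) (hn : 2 ≤ n)
    (U : Set (EuclideanSpace ℝ (Fin n))) (hUopen : IsOpen U)
    (f : EuclideanSpace ℝ (Fin n) → EuclideanSpace ℝ (Fin n))
    -- f is continuous on U
    (hcont : ContinuousOn f U)
    -- f is discrete: every fiber is a discrete subset of U
    (hdisc : ∀ y : EuclideanSpace ℝ (Fin n), ∀ x ∈ U ∩ f ⁻¹' {y},
      ∃ ε > 0, ∀ z ∈ U ∩ f ⁻¹' {y}, z ∈ ball x ε → z = x)
    -- f is open: it maps open subsets of U to open sets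
    (hopen : ∀ V ⊆ U, IsOpen V → IsOpen (f '' V)) :
    ∀ x ∈ U, ∃ rx > (0 : ℝ),
      (∀ r : ℝ, 0 < r → r ≤ rx →
        -- the x-component of f⁻¹(B(f(x),r)) in U
        IsCompact (closure (connectedComponentIn (U ∩ f ⁻¹' ball (f x) r) x)) ∧
        closure (connectedComponentIn (U ∩ f ⁻¹' ball (f x) r) x) ⊆ U ∧
        f '' frontier (connectedComponentIn (U ∩ f ⁻¹' ball (f x) r) x) =
          frontier (f '' connectedComponentIn (U ∩ f ⁻¹' ball (f x) r) x) ∧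
        connectedComponentIn (U ∩ f ⁻¹' ball (f x) r) x ∩ f ⁻¹' {f x} = {x} ∧
        f '' connectedComponentIn (U ∩ f ⁻¹' ball (f x) r) x = ball (f x) r) ∧
      Tendsto (fun r : ℝ => diam (connectedComponentIn (U ∩ f ⁻¹' ball (f x) r) x))
        (𝓝[>] (0 : ℝ)) (𝓝 0) := by
  intro x hx
  obtain ⟨ε₁, hε₁, hfib⟩ := hdisc (f x) x ⟨hx, rfl⟩
  obtain ⟨ε₂, hε₂, hU⟩ := nhds_basis_closedBall.mem_iff.1 (hUopen.mem_nhds hx)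
  have hsmall : ∀ ε, 0 < ε → ε ≤ min (ε₁ / 2) ε₂ →
      closedBall x ε ⊆ U ∧ ∀ z ∈ closedBall x ε, f z = f x → z = x := by
    intro ε _ hle
    have hεU : closedBall x ε ⊆ U :=
      (closedBall_subset_closedBall (hle.trans (min_le_right _ _))).trans hU
    refine ⟨hεU, fun z hz hfz => hfib z ⟨hεU hz, hfz⟩ ?_⟩
    have := hle.trans (min_le_left _ _)
    exact closedBall_subset_ball (by linarith) hz
  have hε₀ : 0 < min (ε₁ / 2) ε₂ := lt_min (half_pos hε₁) hε₂
  obtain ⟨hU₀, hfib₀⟩ := hsmall _ hε₀ le_rfl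
  obtain ⟨δ, hδ, hsub⟩ :=
    exists_connectedComponentIn_preimage_ball_subset_ball hcont hx hε₀ hU₀ hfib₀
  refine ⟨δ, hδ, fun r hr hrδ => ?_, ?_⟩
  · have hCε := (hsub r hr hrδ).trans ball_subset_closedBall
    have hclε := closure_minimal hCε isClosed_closedBall
    have hcpt := (isCompact_closedBall x (min (ε₁ / 2) ε₂)).of_isClosed_subset isClosed_closure hclε
    have hcl := hclε.trans hU₀
    obtain ⟨himg, hfr⟩ :=
      image_connectedComponentIn_preimage_ball hUopen hcont hopen hx hr hcpt hcl
    refine ⟨hcpt, hcl, ?_, ?_, himg⟩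
    · rw [hfr, himg, frontier_ball _ hr.ne']
    · refine Subset.antisymm (fun z hz => hfib₀ z (hCε hz.1) hz.2) ?_
      have hxV : x ∈ U ∩ f ⁻¹' ball (f x) r := mem_inter hx (mem_preimage.2 (mem_ball_self hr))
      exact singleton_subset_iff.2 (mem_inter (mem_connectedComponentIn hxV) rfl)
  · rw [Metric.tendsto_nhds]
    intro η hη
    obtain ⟨ε, hε, hεη, hεle⟩ : ∃ ε, 0 < ε ∧ ε ≤ η / 4 ∧ ε ≤ min (ε₁ / 2) ε₂ :=
      ⟨_, lt_min (by positivity) hε₀, min_le_left _ _, min_le_right _ _⟩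
    obtain ⟨hUε, hfibε⟩ := hsmall ε hε hεle
    obtain ⟨δ', hδ', hsub'⟩ :=
      exists_connectedComponentIn_preimage_ball_subset_ball hcont hx hε hUε hfibε
    filter_upwards [Ioc_mem_nhdsGT hδ'] with r hr
    rw [Real.dist_0_eq_abs, abs_of_nonneg diam_nonneg]
    have hmono := diam_mono (hsub' r hr.1 hr.2) isBounded_ball
    have hball : diam (ball x ε) ≤ 2 * ε := diam_ball hε.le
    linarith
end
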